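/- arXiv:2506.16536 — 2 statements merged into one kernel-verified Lean document; each statement's English description precedes it below -/
import Mathlib

section
/- Let n be a positive integer with n ≠ 6, and let S_n be the symmetric group on n letters. Then the number of isomorphism classes of virtual quandles whose underlying quandle is the conjugation quandle Conj(S_n) equals p(n), the number of partitions of n. For n = 6, this number equals 13. -/
/-- An automorphism of the rack `(X, s)`: a bijection `ψ` with `ψ ∘ s x = s (ψ x) ∘ ψ`. -/
def RackAut {X : Type*} (s : X → Equiv.Perm X) : Type _ :=
  {f : Equiv.Perm X // ∀ x y : X, f (s x y) = s (f x) (f y)}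

/-- Two virtual structures on the rack `(X, s)` give isomorphic virtual racks iff there
is a rack automorphism `ψ` with `ψ ∘ f₁ = f₂ ∘ ψ`. -/
def VirtIso {X : Type*} (s : X → Equiv.Perm X) (f₁ f₂ : RackAut s) : Prop :=
  ∃ ψ : RackAut s, ψ.1 * f₁.1 = f₂.1 * ψ.1

/-- The isomorphism classes of virtual racks whose underlying rack is `(X, s)`. -/
def VirtualClasses {X : Type*} (s : X → Equiv.Perm X) : Type _ :=
  Quot (VirtIso s)

/-- The conjugation quandle structure on a group `G`: `s_x(y) = x y x⁻¹`. -/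
def conjS (G : Type*) [Group G] : G → Equiv.Perm G := fun x =>
  ⟨fun y => x * y * x⁻¹, fun y => x⁻¹ * y * x, fun y => by group, fun y => by group⟩


namespace VQ

open Equiv Equiv.Perm

theorem card_eq_of_surj {X Y Z : Type*} (f : X → Y) (g : X → Z)
    (hf : Function.Surjective f) (hg : Function.Surjective g)
    (h : ∀ x y, f x = f y ↔ g x = g y) : Nat.card Y = Nat.card Z := by
  have e1 := Setoid.quotientKerEquivOfSurjective f hf
  have e2 := Setoid.quotientKerEquivOfSurjective g hg
  have : Setoid.ker f = Setoid.ker g := by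
    ext x y
    simp only [Setoid.ker_def]
    exact h x y
  rw [this] at e1
  exact Nat.card_congr (e1.symm.trans e2)

theorem virt_aux {G : Type*} [Group G] (a f g : G) (h : a * f = g * a) :
    a⁻¹ * g = f * a⁻¹ := by
  rw [inv_mul_eq_iff_eq_mul, ← mul_assoc, h]; simp

theorem virtIso_equiv {X : Type*} (s : X → Equiv.Perm X) : Equivalence (VirtIso s) where
  refl f := ⟨⟨1, fun _ _ => rfl⟩, by simp⟩
  symm := by
    rintro f g ⟨ψ, h⟩
    refine ⟨⟨ψ.1⁻¹, fun x y => ?_⟩, ?_⟩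
    · rw [Equiv.Perm.inv_eq_iff_eq, ψ.2]; simp
    · exact virt_aux _ _ _ h
  trans := by
    rintro f g k ⟨ψ, h⟩ ⟨χ, h'⟩
    refine ⟨⟨χ.1 * ψ.1, fun x y => ?_⟩, ?_⟩
    · simp [ψ.2, χ.2]
    · rw [mul_assoc, h, ← mul_assoc, h', mul_assoc]

theorem mk_eq_iff {X : Type*} (s : X → Equiv.Perm X) (f g : RackAut s) :
    (Quot.mk (VirtIso s) f : VirtualClasses s) = Quot.mk (VirtIso s) g ↔ VirtIso s f g := by
  rw [Quot.eq, (virtIso_equiv s).eqvGen_iff]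

def toRack {G : Type*} [Group G] (f : MulAut G) : RackAut (conjS G) :=
  ⟨f.toEquiv, fun x y => by simp [conjS]⟩

theorem toRack_surj {G : Type*} [Group G] (hc : Subgroup.center G = ⊥) :
    Function.Surjective (toRack (G := G)) := by
  rintro ⟨f, hf⟩
  have hf' : ∀ x y, f (x * y * x⁻¹) = f x * f y * (f x)⁻¹ := hf
  refine ⟨MulEquiv.mk f ?_, Subtype.ext (by ext; rfl)⟩
  intro x y
  have key : (f x * f y)⁻¹ * f (x * y) ∈ Subgroup.center G := by
    rw [Subgroup.mem_center_iff]
    intro g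
    obtain ⟨z, rfl⟩ := f.surjective g
    have h1 := hf' (x * y) z
    have h2 := hf' x (y * z * y⁻¹)
    rw [hf' y z] at h2
    have h3 : x * y * z * (x * y)⁻¹ = x * (y * z * y⁻¹) * x⁻¹ := by group
    rw [h3, h2] at h1
    calc f z * ((f x * f y)⁻¹ * f (x * y))
        = (f x * f y)⁻¹ * (f x * (f y * f z * (f y)⁻¹) * (f x)⁻¹) * f (x * y) := by group
      _ = _ := by rw [h1]; group
  rw [hc, Subgroup.mem_bot] at key
  exact (inv_mul_eq_one.1 key).symm

theorem card_virt {G : Type*} [Group G] (hc : Subgroup.center G = ⊥) :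
    Nat.card (VirtualClasses (conjS G)) = Nat.card (ConjClasses (MulAut G)) := by
  refine card_eq_of_surj (X := MulAut G) (fun f => Quot.mk _ (toRack f)) (fun f => ConjClasses.mk f)
    (Quot.mk_surjective.comp (toRack_surj hc)) ConjClasses.mk_surjective ?_
  intro f g
  refine (mk_eq_iff _ _ _).trans ?_
  rw [ConjClasses.mk_eq_mk_iff_isConj, isConj_iff]
  constructor
  · rintro ⟨ψ, h⟩
    obtain ⟨c, rfl⟩ := toRack_surj hc ψ
    refine ⟨c, ?_⟩
    rw [mul_inv_eq_iff_eq_mul]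
    ext x
    exact DFunLike.congr_fun h x
  · rintro ⟨c, h⟩
    refine ⟨toRack c, ?_⟩
    rw [mul_inv_eq_iff_eq_mul] at h
    ext x
    exact DFunLike.congr_fun h x

theorem center_perm (n : ℕ) (hn : 3 ≤ n) : Subgroup.center (Perm (Fin n)) = ⊥ := by
  rw [eq_bot_iff]
  intro σ hσ
  rw [Subgroup.mem_center_iff] at hσ
  rw [Subgroup.mem_bot]
  ext1 a
  by_contra hne
  simp only [coe_one, id_eq] at hne
  obtain ⟨c, hc⟩ : ∃ c, c ∉ ({a, σ a} : Finset (Fin n)) := by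
    by_contra! h
    have := Finset.card_le_card (Finset.subset_iff.2 (fun x (_ : x ∈ Finset.univ) => h x))
    have h2 := Finset.card_le_two (a := a) (b := σ a)
    simp at this
    omega
  simp only [Finset.mem_insert, Finset.mem_singleton, not_or] at hc
  have := DFunLike.congr_fun (hσ (swap (σ a) c)) a
  simp only [coe_mul, Function.comp_apply, swap_apply_left] at this
  rw [swap_apply_of_ne_of_ne (Ne.symm hne) (Ne.symm hc.1)] at this
  exact hc.2 this

theorem partition_surj {α : Type*} [Fintype α] [DecidableEq α] :
    Function.Surjective (fun σ : Perm α => σ.partition) := by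
  intro p
  have hsum : (p.parts.filter (2 ≤ ·)).sum + (p.parts.filter (¬ 2 ≤ ·)).sum = Fintype.card α := by
    rw [← Multiset.sum_add, Multiset.filter_add_not, p.parts_sum]
  have hone : p.parts.filter (¬ 2 ≤ ·) =
      Multiset.replicate (Multiset.card (p.parts.filter (¬ 2 ≤ ·))) 1 := by
    rw [Multiset.eq_replicate_card]
    intro b hb
    rw [Multiset.mem_filter] at hb
    have := p.parts_pos hb.1
    omega
  obtain ⟨σ, hσ⟩ := (Equiv.Perm.exists_with_cycleType_iff α
    (m := p.parts.filter (2 ≤ ·))).2 ⟨by omega, fun a ha => (Multiset.mem_filter.1 ha).2⟩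
  refine ⟨σ, ?_⟩
  ext1
  simp only
  rw [parts_partition, ← sum_cycleType, hσ]
  conv_rhs => rw [← Multiset.filter_add_not (2 ≤ ·) p.parts]
  congr 1
  rw [hone] at hsum ⊢
  simp only [Multiset.sum_replicate, smul_eq_mul, mul_one] at hsum
  congr 1
  omega

theorem center_inj {G : Type*} [Group G] (hc : Subgroup.center G = ⊥) :
    Function.Injective (MulAut.conj (G := G)) := by
  rw [injective_iff_map_eq_one]
  intro a ha
  rw [← Subgroup.mem_bot, ← hc, Subgroup.mem_center_iff]
  intro g
  have := DFunLike.congr_fun ha g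
  simp only [MulAut.conj_apply, MulAut.one_apply] at this
  exact (mul_inv_eq_iff_eq_mul.1 this).symm

/-- star transpositions generate -/
theorem star_induction {n : ℕ} (z : Fin n) (H : Subgroup (Perm (Fin n)))
    (h : ∀ j, j ≠ z → swap z j ∈ H) : H = ⊤ := by
  rw [eq_top_iff, ← Equiv.Perm.closure_isSwap, Subgroup.closure_le]
  rintro σ ⟨x, y, hxy, rfl⟩
  by_cases hx : x = z
  · subst hx; exact h y hxy.symm
  by_cases hy : y = z
  · subst hy; rw [swap_comm]; exact h x hx
  have : swap x y = swap z x * swap y z * swap z x := by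
    exact (swap_mul_swap_mul_swap (x := y) hy (Ne.symm hxy) ▸ rfl)
  rw [this]
  exact H.mul_mem (H.mul_mem (h x hx) (swap_comm y z ▸ h y hy)) (h x hx)

end VQ

namespace VQ
open Equiv Equiv.Perm

theorem exists_notMem_list {n : ℕ} (l : List (Fin n)) (h : l.length < n) : ∃ c, c ∉ l := by
  by_contra! hc
  have h1 : (Finset.univ : Finset (Fin n)) ⊆ l.toFinset := fun x _ => by simpa using hc x
  have := Finset.card_le_card h1
  have h2 := l.toFinset_card_le
  simp at this
  omega

/-- Two swaps which do not commute share exactly one point. -/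
theorem swaps_share {n : ℕ} {s t : Perm (Fin n)} (hs : s.IsSwap) (ht : t.IsSwap)
    (h : s * t ≠ t * s) : ∃ a b c, a ≠ b ∧ a ≠ c ∧ b ≠ c ∧ s = swap a b ∧ t = swap a c := by
  obtain ⟨x, y, hxy, rfl⟩ := hs
  obtain ⟨z, w, hzw, rfl⟩ := ht
  by_cases h1 : x = z
  · subst h1
    refine ⟨x, y, w, hxy, hzw, ?_, rfl, rfl⟩
    rintro rfl; exact h rfl
  by_cases h2 : x = w
  · subst h2
    refine ⟨x, y, z, hxy, h1, ?_, rfl, swap_comm _ _⟩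
    rintro rfl; exact h (by rw [swap_comm])
  by_cases h3 : y = z
  · subst h3
    exact ⟨y, x, w, hxy.symm, hzw, h2, swap_comm _ _, rfl⟩
  by_cases h4 : y = w
  · subst h4
    exact ⟨y, x, z, hxy.symm, h3, h1, swap_comm _ _, swap_comm _ _⟩
  exfalso
  apply h
  apply Equiv.Perm.Disjoint.commute
  rw [Equiv.Perm.disjoint_iff_eq_or_eq]
  intro u
  by_cases hu : u = x ∨ u = y
  · right
    rcases hu with rfl | rfl <;> exact swap_apply_of_ne_of_ne (by assumption) (by assumption)
  · left
    push Not at hu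
    exact swap_apply_of_ne_of_ne hu.1 hu.2

theorem swap_inj_left {n : ℕ} {a b c : Fin n} (h : swap a b = swap a c) : b = c := by
  have := DFunLike.congr_fun h a
  simpa using this

theorem inner_of_swaps {n : ℕ} (hn : 3 ≤ n) (f : MulAut (Perm (Fin n)))
    (hf : ∀ s : Perm (Fin n), s.IsSwap → (f s).IsSwap) : ∃ g, f = MulAut.conj g := by
  obtain ⟨z, hz⟩ : ∃ z : Fin n, z = ⟨0, by omega⟩ := ⟨_, rfl⟩
  obtain ⟨o, ho⟩ : ∃ z : Fin n, z = ⟨1, by omega⟩ := ⟨_, rfl⟩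
  obtain ⟨w, hw⟩ : ∃ z : Fin n, z = ⟨2, by omega⟩ := ⟨_, rfl⟩
  have hoz : o ≠ z := by subst hz ho; simp
  have hwz : w ≠ z := by subst hz hw; simp
  have how : o ≠ w := by subst ho hw; simp
  have hnc : ∀ i j : Fin n, i ≠ z → j ≠ z → i ≠ j →
      f (swap z i) * f (swap z j) ≠ f (swap z j) * f (swap z i) := by
    intro i j hi hj hij h
    rw [← map_mul, ← map_mul] at h
    have := DFunLike.congr_fun (f.injective h) z
    simp only [coe_mul, Function.comp_apply, swap_apply_left] at this
    rw [swap_apply_of_ne_of_ne hj (Ne.symm hij), swap_apply_of_ne_of_ne hi hij] at this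
    exact hij this.symm
  have hsw : ∀ i, i ≠ z → (f (swap z i)).IsSwap := fun i hi => hf _ ⟨z, i, hi.symm, rfl⟩
  obtain ⟨a, b, c, hab, hac, hbc, h1, h2⟩ := swaps_share (hsw o hoz) (hsw w hwz) (hnc o w hoz hwz how)
  -- every star swap maps to a swap containing a
  have key : ∀ j, j ≠ z → ∃ d, d ≠ a ∧ f (swap z j) = swap a d := by
    intro j hj
    by_cases hjo : j = o
    · subst hjo; exact ⟨b, hab.symm, h1⟩
    by_cases hjw : j = w
    · subst hjw; exact ⟨c, hac.symm, h2⟩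
    obtain ⟨x, y, u, hxy, hxu, hyu, e1, e2⟩ :=
      swaps_share (hsw o hoz) (hsw j hj) (hnc o j hoz hj (Ne.symm hjo))
    rw [h1] at e1
    by_cases hxa : x = a
    · subst hxa; exact ⟨u, hxu.symm, e2⟩
    have hxb : x = b ∧ y = a := by
      have hA := DFunLike.congr_fun e1 a
      rw [swap_apply_left] at hA
      by_cases hya : y = a
      · subst hya; rw [swap_apply_right] at hA; exact ⟨hA.symm, rfl⟩
      · rw [swap_apply_of_ne_of_ne (Ne.symm hxa) (Ne.symm hya)] at hA
        exact absurd hA.symm hab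
    obtain ⟨rfl, rfl⟩ := hxb
    -- now f (swap z j) = swap b u
    by_cases huc : u = c
    · exfalso
      subst huc
      have e3 : f (swap z o * swap z w * swap z o) = f (swap z j) := by
        rw [map_mul, map_mul, h1, h2, e2]
        have := swap_mul_swap_mul_swap (x := u) (y := y) (z := x) hac.symm (Ne.symm hbc)
        rw [← this, swap_comm u y]
      have := DFunLike.congr_fun (f.injective e3) z
      simp only [coe_mul, Function.comp_apply, swap_apply_left] at this
      rw [swap_apply_of_ne_of_ne hoz how, swap_apply_right] at this
      exact hj this.symm
    · exfalso
      apply hnc w j hwz hj (Ne.symm hjw)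
      rw [h2, e2]
      apply Equiv.Perm.Disjoint.commute
      rw [Equiv.Perm.disjoint_iff_eq_or_eq]
      intro v
      by_cases hv : v = y ∨ v = c
      · right
        rcases hv with rfl | rfl
        · exact swap_apply_of_ne_of_ne hab hyu
        · exact swap_apply_of_ne_of_ne (Ne.symm hbc) (Ne.symm huc)
      · left
        push Not at hv
        exact swap_apply_of_ne_of_ne hv.1 hv.2
  choose! d hd hfd using key
  let g0 : Fin n → Fin n := fun j => if j = z then a else d j
  have hinj : Function.Injective g0 := by
    intro i j hij
    simp only [g0] at hij
    by_cases hi : i = z <;> by_cases hj : j = z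
    · rw [hi, hj]
    · rw [if_pos hi, if_neg hj] at hij; exact absurd hij.symm (hd j hj)
    · rw [if_neg hi, if_pos hj] at hij; exact absurd hij (hd i hi)
    · rw [if_neg hi, if_neg hj] at hij
      have : f (swap z i) = f (swap z j) := by rw [hfd i hi, hfd j hj, hij]
      exact swap_inj_left (f.injective this)
  let g : Perm (Fin n) := Equiv.ofBijective g0 (Finite.injective_iff_bijective.1 hinj)
  refine ⟨g, ?_⟩
  have htop := star_induction z (MonoidHom.eqLocus f.toMonoidHom (MulAut.conj g).toMonoidHom) (by
    intro j hj
    change f (swap z j) = MulAut.conj g (swap z j)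
    rw [MulAut.conj_apply, hfd j hj, ← swap_apply_apply]
    congr 1
    · simp [g, g0]
    · simp [g, g0, hj])
  ext1 x
  have : x ∈ MonoidHom.eqLocus f.toMonoidHom (MulAut.conj g).toMonoidHom := by
    rw [htop]; trivial
  exact this

theorem swap_prod_pow {n : ℕ} (s t : Perm (Fin n)) (hs : s.IsSwap) (ht : t.IsSwap) :
    (s * t) ^ 2 = 1 ∨ (s * t) ^ 3 = 1 := by
  by_cases h : s * t = t * s
  · left
    obtain ⟨x, y, hxy, rfl⟩ := hs
    obtain ⟨z, w, hzw, rfl⟩ := ht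
    have hc : Commute (swap x y) (swap z w) := h
    rw [hc.mul_pow, pow_two, pow_two]; simp
  · right
    obtain ⟨a, b, c, hab, hac, hbc, rfl, rfl⟩ := swaps_share hs ht h
    have := (Equiv.Perm.isThreeCycle_swap_mul_swap_same hab hac hbc).orderOf
    rw [← this]; exact pow_orderOf_eq_one _

theorem swap_isConj {n : ℕ} {s t : Perm (Fin n)} (hs : s.IsSwap) (ht : t.IsSwap) : IsConj s t := by
  obtain ⟨x, y, hxy, rfl⟩ := hs
  obtain ⟨z, w, hzw, rfl⟩ := ht
  exact Equiv.Perm.isConj_swap hxy hzw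

/-- If the image of a swap is `t`, then conjugates of `t` have products of order at most 3. -/
theorem conj_prod_pow {n : ℕ} (f : MulAut (Perm (Fin n))) (s : Perm (Fin n)) (hs : s.IsSwap)
    (c : Perm (Fin n)) : (f s * (c * f s * c⁻¹)) ^ 2 = 1 ∨ (f s * (c * f s * c⁻¹)) ^ 3 = 1 := by
  obtain ⟨c, rfl⟩ := f.surjective c
  have h : (c * s * c⁻¹).IsSwap := by
    obtain ⟨x, y, hxy, rfl⟩ := hs
    exact ⟨c x, c y, by simpa using hxy, (swap_apply_apply _ _ _).symm⟩
  have := swap_prod_pow s _ hs h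
  rcases this with h | h
  · left
    rw [← map_inv, ← map_mul, ← map_mul, ← map_mul, ← map_pow, h, map_one]
  · right
    rw [← map_inv, ← map_mul, ← map_mul, ← map_mul, ← map_pow, h, map_one]

theorem four_aux : ∀ s t : Perm (Fin 4), s * s = 1 → t * t = 1 → (∀ x, s x ≠ x) → (∀ x, t x ≠ x) →
    (s * t) ^ 2 = 1 := by
  decide +kernel

set_option linter.unusedSimpArgs false in
theorem auto_swap {n : ℕ} (hn : 3 ≤ n) (h6 : n ≠ 6) (f : MulAut (Perm (Fin n))) (s : Perm (Fin n))
    (hs : s.IsSwap) : (f s).IsSwap := by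
  have hcp := conj_prod_pow f s hs
  have ht : ∀ x, f s (f s x) = x := by
    intro x
    have : f s * f s = 1 := by
      obtain ⟨x, y, hxy, rfl⟩ := hs
      rw [← map_mul]; simp
    exact DFunLike.congr_fun this x
  have hinj := (f s).injective
  have hne : f s ≠ 1 := by
    intro h
    rw [MulEquiv.map_eq_one_iff] at h
    obtain ⟨x, y, hxy, rfl⟩ := hs
    exact hxy (swap_eq_one_iff.1 h)
  by_contra hns
  obtain ⟨t, htt⟩ : ∃ t, t = f s := ⟨_, rfl⟩
  rw [← htt] at hcp ht hinj hne hns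
  obtain ⟨a, b, hab', hab⟩ : ∃ a b, t a = b ∧ a ≠ b := by
    by_contra! h
    exact hne (by ext1 x; exact (h x _ rfl).symm)
  have hba : t b = a := by rw [← hab', ht]
  obtain ⟨c, d, hcd', hcd, hca, hcb⟩ : ∃ c d, t c = d ∧ c ≠ d ∧ c ≠ a ∧ c ≠ b := by
    by_contra! h
    apply hns
    refine ⟨a, b, hab, ?_⟩
    ext1 x
    by_cases hxa : x = a
    · subst hxa; simpa using hab'
    by_cases hxb : x = b
    · subst hxb; simpa using hba
    rw [swap_apply_of_ne_of_ne hxa hxb]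
    by_contra hx
    exact hxb (h x _ rfl (Ne.symm hx) hxa)
  have hdc : t d = c := by rw [← hcd', ht]
  have hda : d ≠ a := by rintro rfl; exact hcb (by rw [← hdc, hab'])
  have hdb : d ≠ b := by rintro rfl; exact hca (by rw [← hdc, hba])
  by_cases hfix : ∃ e, t e = e
  · obtain ⟨e, he⟩ := hfix
    have hea : e ≠ a := by rintro rfl; exact hab (he.symm.trans hab')
    have heb : e ≠ b := by rintro rfl; exact hab (hba.symm.trans he)
    have hec : e ≠ c := by rintro rfl; exact hcd (he.symm.trans hcd')
    have hed : e ≠ d := by rintro rfl; exact hcd (hdc.symm.trans he)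
    rcases hcp (swap b c * swap d e) with h | h <;>
    · have := DFunLike.congr_fun h a
      simp [pow_succ, swap_apply_def, hab', hba, hcd', hdc, he, hab, hca, hcb, hcd, hda, hdb, hea, heb, hec, hed, hab.symm, hca.symm, hcb.symm, hcd.symm, hda.symm, hdb.symm, hea.symm, heb.symm, hec.symm, hed.symm] at this
  push Not at hfix
  have hn4 : n ≠ 4 := by
    rintro rfl
    obtain ⟨x, y, hxy, rfl⟩ := hs
    obtain ⟨z, hz⟩ := exists_notMem_list [x, y] (by simp)
    simp only [List.mem_cons, List.not_mem_nil, or_false, not_or] at hz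
    obtain ⟨g, hg⟩ := isConj_iff.1 (Equiv.Perm.isConj_swap hxy (Ne.symm hz.1))
    have h1 : f (swap x z) = f g * t * (f g)⁻¹ := by
      rw [htt, ← map_inv, ← map_mul, ← map_mul, hg]
    have h2 := four_aux t (f (swap x z)) (by ext1 u; exact ht u) (by rw [← map_mul]; simp) hfix (by
      intro u hu
      rw [h1] at hu
      simp only [coe_mul, Function.comp_apply] at hu
      rw [← Equiv.Perm.eq_inv_iff_eq] at hu
      exact hfix _ hu)
    rw [htt, ← map_mul, ← map_pow, MulEquiv.map_eq_one_iff] at h2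
    have h3 := (Equiv.Perm.isThreeCycle_swap_mul_swap_same hxy (Ne.symm hz.1) (Ne.symm hz.2)).orderOf
    have h4 := orderOf_dvd_of_pow_eq_one h2
    rw [h3] at h4
    omega
  have h4 : 4 < n := by
    have : ([a, b, c, d] : List (Fin n)).Nodup := by
      simp [hab, hcd, hca.symm, hcb.symm, hda.symm, hdb.symm]
    have := this.length_le_card
    simp at this
    omega
  obtain ⟨e, he⟩ := exists_notMem_list [a, b, c, d] (by simpa using h4)
  simp only [List.mem_cons, List.not_mem_nil, or_false, not_or] at he
  obtain ⟨hea, heb, hec, hed⟩ := he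
  obtain ⟨k, hek'⟩ : ∃ k, t e = k := ⟨_, rfl⟩
  have hke : t k = e := by rw [← hek', ht]
  have hek : e ≠ k := by rw [← hek']; exact (hfix e).symm
  have hka : k ≠ a := by rintro rfl; exact heb (by rw [← hke, hab'])
  have hkb : k ≠ b := by rintro rfl; exact hea (by rw [← hke, hba])
  have hkc : k ≠ c := by rintro rfl; exact hed (by rw [← hke, hcd'])
  have hkd : k ≠ d := by rintro rfl; exact hec (by rw [← hke, hdc])
  have h6' : 6 < n := by
    have : ([a, b, c, d, e, k] : List (Fin n)).Nodup := by
      simp [hab, hcd, hca.symm, hcb.symm, hda.symm, hdb.symm, Ne.symm hea, Ne.symm heb, Ne.symm hec, Ne.symm hed,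
        hka.symm, hkb.symm, hkc.symm, hkd.symm, hek]
    have := this.length_le_card
    simp at this
    omega
  obtain ⟨p, hp⟩ := exists_notMem_list [a, b, c, d, e, k] (by simpa using h6')
  simp only [List.mem_cons, List.not_mem_nil, or_false, not_or] at hp
  obtain ⟨hpa, hpb, hpc, hpd, hpe, hpk⟩ := hp
  obtain ⟨q, hpq'⟩ : ∃ q, t p = q := ⟨_, rfl⟩
  have hqp : t q = p := by rw [← hpq', ht]
  have hpq : p ≠ q := by rw [← hpq']; exact (hfix p).symm
  have hqa : q ≠ a := by rintro rfl; exact hpb (by rw [← hqp, hab'])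
  have hqb : q ≠ b := by rintro rfl; exact hpa (by rw [← hqp, hba])
  have hqc : q ≠ c := by rintro rfl; exact hpd (by rw [← hqp, hcd'])
  have hqd : q ≠ d := by rintro rfl; exact hpc (by rw [← hqp, hdc])
  have hqe : q ≠ e := by rintro rfl; exact hpk (by rw [← hqp, hek'])
  have hqk : q ≠ k := by rintro rfl; exact hpe (by rw [← hqp, hke])
  rcases hcp (swap a c * swap c e * swap e p) with h | h <;>
  · have := DFunLike.congr_fun h a
    simp [pow_succ, swap_apply_def, hab', hba, hcd', hdc, hek', hke, hpq', hqp,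
      hab, hca, hcb, hcd, hda, hdb, hea, heb, hec, hed, hka, hkb, hkc, hkd, hek,
      hpa, hpb, hpc, hpd, hpe, hpk, hqa, hqb, hqc, hqd, hqe, hqk, hpq,
      hab.symm, hca.symm, hcb.symm, hcd.symm, hda.symm, hdb.symm, Ne.symm hea, Ne.symm heb, Ne.symm hec,
      Ne.symm hed, hka.symm, hkb.symm, hkc.symm, hkd.symm, hek.symm,
      Ne.symm hpa, Ne.symm hpb, Ne.symm hpc, Ne.symm hpd, Ne.symm hpe, Ne.symm hpk,
      hqa.symm, hqb.symm, hqc.symm, hqd.symm, hqe.symm, hqk.symm, hpq.symm] at this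

end VQ

namespace VQ
open Equiv Equiv.Perm

theorem main_ne_six (n : ℕ) (hn : 3 ≤ n) (h6 : n ≠ 6) :
    Nat.card (VirtualClasses (conjS (Perm (Fin n)))) = Fintype.card (Nat.Partition n) := by
  rw [card_virt (center_perm n hn)]
  have h1 : Nat.card (ConjClasses (MulAut (Perm (Fin n)))) =
      Nat.card (Nat.Partition (Fintype.card (Fin n))) := by
    refine card_eq_of_surj (X := Perm (Fin n)) (fun σ => ConjClasses.mk (MulAut.conj σ))
      (fun σ => σ.partition) ?_ partition_surj ?_
    · refine ConjClasses.mk_surjective.comp ?_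
      intro f
      obtain ⟨g, hg⟩ := inner_of_swaps hn f (auto_swap hn h6 f)
      exact ⟨g, hg.symm⟩
    · intro σ τ
      rw [ConjClasses.mk_eq_mk_iff_isConj, ← partition_eq_of_isConj]
      constructor
      · intro h
        obtain ⟨c, hc⟩ := isConj_iff.1 h
        obtain ⟨g, hg⟩ := inner_of_swaps hn c (auto_swap hn h6 c)
        subst hg
        rw [← map_inv, ← map_mul, ← map_mul] at hc
        exact isConj_iff.2 ⟨g, center_inj (center_perm n hn) hc⟩
      · intro h
        exact MonoidHom.map_isConj _ h
  rw [h1, Nat.card_eq_fintype_card, Fintype.card_fin]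

theorem main_small (n : ℕ) (hn : n = 1 ∨ n = 2) :
    Nat.card (VirtualClasses (conjS (Perm (Fin n)))) = Fintype.card (Nat.Partition n) := by
  have hcomm : ∀ a b : Perm (Fin n), a * b = b * a := by
    rcases hn with rfl | rfl <;> decide
  have hcomm2 : ∀ a b : Perm (Perm (Fin n)), a * b = b * a := by
    rcases hn with rfl | rfl <;> decide
  have h1 : Nat.card (VirtualClasses (conjS (Perm (Fin n)))) = Nat.card (Perm (Perm (Fin n))) := by
    refine card_eq_of_surj (X := RackAut (conjS (Perm (Fin n)))) (fun f => Quot.mk _ f)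
      (fun f => f.1) Quot.mk_surjective ?_ ?_
    · intro f
      refine ⟨⟨f, fun x y => ?_⟩, rfl⟩
      have : ∀ x y : Perm (Fin n), conjS (Perm (Fin n)) x y = y := by
        intro x y
        change x * y * x⁻¹ = y
        rw [hcomm x y]; simp
      rw [this, this]
    · intro f g
      refine (mk_eq_iff _ _ _).trans ?_
      constructor
      · rintro ⟨ψ, h⟩
        have h' := (hcomm2 _ _).symm.trans h
        exact mul_right_cancel h'
      · intro h
        have : f = g := Subtype.ext h
        subst this
        exact (virtIso_equiv _).refl _
  have h2 : Nat.card (Perm (Fin n)) = Nat.card (Nat.Partition (Fintype.card (Fin n))) := by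
    refine card_eq_of_surj (X := Perm (Fin n)) id (fun σ => σ.partition) Function.surjective_id
      partition_surj ?_
    intro σ τ
    refine ⟨fun h => by rw [show σ = τ from h], fun h => ?_⟩
    have : ∀ σ τ : Perm (Fin n), σ.partition.parts = τ.partition.parts → σ = τ := by
      rcases hn with rfl | rfl <;> decide +kernel
    exact this σ τ (by simpa using congrArg Nat.Partition.parts h)
  have h3 : Nat.card (Nat.Partition (Fintype.card (Fin n))) = Fintype.card (Nat.Partition n) := by
    rw [Nat.card_eq_fintype_card, Fintype.card_fin]
  rw [h1, ← h3, ← h2, Nat.card_eq_fintype_card, Nat.card_eq_fintype_card]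
  rcases hn with rfl | rfl <;> decide +kernel

end VQ

namespace VQ
open Equiv Equiv.Perm

/-- All compositions of `n` with at most `k` parts. -/
def comps : ℕ → ℕ → List (List ℕ)
  | 0, n => if n = 0 then [[]] else []
  | k + 1, n => if n = 0 then [[]] else
      (List.range n).flatMap (fun i => (comps k (n - (i + 1))).map (List.cons (i + 1)))

theorem mem_comps (l : List ℕ) : ∀ k n, n ≤ k → (∀ x ∈ l, 0 < x) → l.sum = n → l ∈ comps k n := by
  induction l with
  | nil =>
    intro k n _ _ h
    simp only [List.sum_nil] at h
    subst h
    cases k <;> simp [comps]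
  | cons x l ih =>
    intro k n hk hpos h
    have hx := hpos x (by simp)
    simp only [List.sum_cons] at h
    cases k with
    | zero => omega
    | succ k =>
      have hn : n ≠ 0 := by omega
      simp only [comps, if_neg hn, List.mem_flatMap, List.mem_range, List.mem_map]
      refine ⟨x - 1, by omega, l, ?_, ?_⟩
      · exact ih k _ (by omega) (fun y hy => hpos y (by simp [hy])) (by omega)
      · congr 1
        omega

/-- The eleven partitions of `6`. -/
def LP : List (Nat.Partition 6) :=
  [⟨{6}, by decide, by decide⟩,
   ⟨{5, 1}, by decide, by decide⟩,
   ⟨{4, 2}, by decide, by decide⟩,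
   ⟨{4, 1, 1}, by decide, by decide⟩,
   ⟨{3, 3}, by decide, by decide⟩,
   ⟨{3, 2, 1}, by decide, by decide⟩,
   ⟨{3, 1, 1, 1}, by decide, by decide⟩,
   ⟨{2, 2, 2}, by decide, by decide⟩,
   ⟨{2, 2, 1, 1}, by decide, by decide⟩,
   ⟨{2, 1, 1, 1, 1}, by decide, by decide⟩,
   ⟨{1, 1, 1, 1, 1, 1}, by decide, by decide⟩]

theorem mem_LP (p : Nat.Partition 6) : p ∈ LP := by
  have h : p.parts ∈ LP.map Nat.Partition.parts := by
    have h1 : p.parts.toList ∈ comps 6 6 := by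
      refine mem_comps _ 6 6 le_rfl ?_ ?_
      · intro x hx
        exact p.parts_pos (Multiset.mem_toList.1 hx)
      · rw [Multiset.sum_toList, p.parts_sum]
    have h2 : ∀ l ∈ comps 6 6, (l : Multiset ℕ) ∈ LP.map Nat.Partition.parts := by
      decide +kernel
    have := h2 _ h1
    rwa [Multiset.coe_toList] at this
  obtain ⟨q, hq, e⟩ := List.mem_map.1 h
  rwa [← Nat.Partition.ext e]

theorem univ_LP : (Finset.univ : Finset (Nat.Partition 6)) = LP.toFinset := by
  ext p
  simp [mem_LP p]

def keyP (p : Nat.Partition 6) : ℕ × ℤˣ :=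
  ((p.parts.filter (2 ≤ ·)).lcm,
    (-1) ^ ((p.parts.filter (2 ≤ ·)).sum + Multiset.card (p.parts.filter (2 ≤ ·))))

theorem keyP_two (p q r : Nat.Partition 6) : keyP p = keyP q → keyP r = keyP p → p ≠ q → r ≠ p →
    r = q := by
  have : (LP.all fun p => LP.all fun q => LP.all fun r =>
      decide (keyP p = keyP q → keyP r = keyP p → p ≠ q → r ≠ p → r = q)) = true := by
    decide +kernel
  simp only [List.all_eq_true, decide_eq_true_eq] at this
  exact this p (mem_LP p) q (mem_LP q) r (mem_LP r)

theorem amb_list (p q : Nat.Partition 6) : keyP p = keyP q → p ≠ q →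
    p.parts = {2,1,1,1,1} ∨ p.parts = {2,2,2} ∨ p.parts = {3,1,1,1} ∨ p.parts = {3,3} ∨
      p.parts = {6} ∨ p.parts = {3,2,1} := by
  have : (LP.all fun p => LP.all fun q => decide (keyP p = keyP q → p ≠ q →
      p.parts = {2,1,1,1,1} ∨ p.parts = {2,2,2} ∨ p.parts = {3,1,1,1} ∨ p.parts = {3,3} ∨
        p.parts = {6} ∨ p.parts = {3,2,1})) = true := by
    decide +kernel
  simp only [List.all_eq_true, decide_eq_true_eq] at this
  exact this p (mem_LP p) q (mem_LP q)

theorem card_keyP : Nat.card (Set.range keyP) = 8 := by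
  have h : Set.range keyP = (LP.toFinset.image keyP : Finset _) := by
    rw [← univ_LP]; simp
  rw [h, Nat.card_coe_set_eq, Set.ncard_coe_finset]
  decide +kernel

/-- Partitions determined by their key. -/
def Unamb (p : Nat.Partition 6) : Prop := ∀ q, keyP q = keyP p → q = p

theorem card_unamb : Nat.card {p // Unamb p} = 5 := by
  have h : {p | Unamb p} = (LP.toFinset.filter (fun p => (LP.all fun q =>
      decide (keyP q = keyP p → q = p)) = true) :
      Finset _) := by
    ext p
    simp [Unamb, mem_LP, -decide_implies]
  change Nat.card {p | Unamb p} = 5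
  rw [h, Nat.card_coe_set_eq, Set.ncard_coe_finset]
  decide +kernel

theorem part1 : (swap 0 1 : Perm (Fin 6)).partition.parts = {2,1,1,1,1} := by decide +kernel
theorem part2 : (swap 0 1 * swap 2 3 * swap 4 5 : Perm (Fin 6)).partition.parts = {2,2,2} := by
  decide +kernel
theorem part3 : (swap 0 1 * swap 1 2 : Perm (Fin 6)).partition.parts = {3,1,1,1} := by
  decide +kernel
theorem part4 : (swap 0 5 * swap 5 2 * (swap 1 3 * swap 3 4) : Perm (Fin 6)).partition.parts =
    {3,3} := by
  decide +kernel
theorem part5 : (swap 0 1 * swap 1 2 * swap 2 3 * swap 3 4 * swap 4 5 :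
    Perm (Fin 6)).partition.parts = {6} := by
  decide +kernel
theorem part6 : (swap 1 4 * (swap 2 3 * swap 3 5) : Perm (Fin 6)).partition.parts = {3,2,1} := by
  decide +kernel

def D (i j a b : Fin 6) : Bool :=
  Nat.testBit 2503272926264009209953219888903058680904850126481794387223378094773519860128394954742062493873456425741583192474673841809476220300881730788307677330786015293614017453494851825028664126149455898930857158841070401214323694477827962085803705423897242396720069921146808959243919458793588456197283287179960925139478991511997542640475800796408562253038422314321394921574306968844107776
    (((i.val * 6 + j.val) * 6 + a.val) * 6 + b.val)

theorem D_symm : ∀ i j a b, D i j a b = D a b i j := by decide +kernel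

theorem D_sep : ∀ a b c d : Fin 6, a ≠ b → (∀ i j, D i j a b = D i j c d) →
    (a = c ∧ b = d) ∨ (a = d ∧ b = c) := by decide +kernel

def Hrel (σ π : Perm (Fin 6)) : Prop := ∀ i j a b, D i j a b = D (σ i) (σ j) (π a) (π b)

instance (σ π : Perm (Fin 6)) : Decidable (Hrel σ π) := by unfold Hrel; infer_instance

theorem h1 : Hrel (swap 0 1) (swap 0 1 * swap 2 3 * swap 4 5) := by decide +kernel
theorem h2 : Hrel (swap 0 2) (swap 0 3 * swap 1 5 * swap 2 4) := by decide +kernel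
theorem h3 : Hrel (swap 0 3) (swap 0 2 * swap 1 4 * swap 3 5) := by decide +kernel
theorem h4 : Hrel (swap 0 4) (swap 0 5 * swap 1 2 * swap 3 4) := by decide +kernel
theorem h5 : Hrel (swap 0 5) (swap 0 4 * swap 1 3 * swap 2 5) := by decide +kernel
theorem h33 : Hrel (swap 0 1 * swap 1 2) (swap 0 5 * swap 5 2 * (swap 1 3 * swap 3 4)) := by
  decide +kernel
theorem h66 : Hrel (swap 0 1 * swap 1 2 * swap 2 3 * swap 3 4 * swap 4 5)
    (swap 1 4 * (swap 2 3 * swap 3 5)) := by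
  decide +kernel

end VQ

namespace VQ
open Equiv Equiv.Perm

abbrev S6 := Perm (Fin 6)

theorem Hrel_mul {σ π σ' π' : S6} (h : Hrel σ π) (h' : Hrel σ' π') : Hrel (σ * σ') (π * π') := by
  intro i j a b
  rw [h' i j a b, h]
  rfl

theorem Hrel_inv {σ π : S6} (h : Hrel σ π) : Hrel σ⁻¹ π⁻¹ := by
  intro i j a b
  rw [h (σ⁻¹ i) (σ⁻¹ j) (π⁻¹ a) (π⁻¹ b)]
  simp

theorem Hrel_symm {σ π : S6} (h : Hrel σ π) : Hrel π σ := by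
  intro i j a b
  rw [D_symm, h a b i j, D_symm]

theorem Hrel_one {π : S6} (h : Hrel 1 π) : π = 1 := by
  have key : ∀ a b, a ≠ b → (a = π a ∧ b = π b) ∨ (a = π b ∧ b = π a) := fun a b hab =>
    D_sep a b (π a) (π b) hab (fun i j => h i j a b)
  ext1 a
  by_contra hne
  simp only [coe_one, id_eq] at hne
  obtain ⟨c, hc⟩ := exists_notMem_list [a, π a] (by simp)
  simp only [List.mem_cons, List.not_mem_nil, or_false, not_or] at hc
  rcases key a c (Ne.symm hc.1) with h | h
  · exact hne h.1.symm
  · exact hc.2 h.2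

theorem Hrel_unique {σ π π' : S6} (h : Hrel σ π) (h' : Hrel σ π') : π = π' := by
  have := Hrel_mul (Hrel_inv h) h'
  rw [inv_mul_cancel] at this
  exact inv_mul_eq_one.1 (Hrel_one this)

theorem Hrel_exists (σ : S6) : ∃ π, Hrel σ π := by
  let K : Subgroup S6 :=
    { carrier := {σ | ∃ π, Hrel σ π}
      mul_mem' := by
        rintro a b ⟨π, h⟩ ⟨π', h'⟩
        exact ⟨_, Hrel_mul h h'⟩
      one_mem' := ⟨1, fun _ _ _ _ => rfl⟩
      inv_mem' := by
        rintro a ⟨π, h⟩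
        exact ⟨_, Hrel_inv h⟩ }
  have : K = ⊤ := by
    refine star_induction 0 K ?_
    intro j hj
    fin_cases j
    · exact absurd rfl hj
    · exact ⟨_, h1⟩
    · exact ⟨_, h2⟩
    · exact ⟨_, h3⟩
    · exact ⟨_, h4⟩
    · exact ⟨_, h5⟩
  have h : σ ∈ K := by rw [this]; trivial
  exact h

noncomputable def phi0 (σ : S6) : S6 := (Hrel_exists σ).choose

theorem phi0_spec (σ : S6) : Hrel σ (phi0 σ) := (Hrel_exists σ).choose_spec

/-- The exotic automorphism of the symmetric group on six letters. -/
noncomputable def phi : MulAut S6 :=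
  { toFun := phi0
    invFun := phi0
    left_inv := fun σ => Hrel_unique (phi0_spec _) (Hrel_symm (phi0_spec σ))
    right_inv := fun σ => Hrel_unique (phi0_spec _) (Hrel_symm (phi0_spec σ))
    map_mul' := fun σ τ => Hrel_unique (phi0_spec _) (Hrel_mul (phi0_spec _) (phi0_spec _)) }

theorem phi_eq {σ π : S6} (h : Hrel σ π) : phi σ = π := Hrel_unique (phi0_spec σ) h

theorem phi_phi (σ : S6) : phi (phi σ) = σ := phi.left_inv σ

/-- the partition of a permutation of six letters -/
def pt (σ : S6) : Nat.Partition 6 := σ.partition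

theorem pt_surj : Function.Surjective pt := partition_surj (α := Fin 6)

theorem pt_conj {σ τ : S6} : IsConj σ τ ↔ pt σ = pt τ := partition_eq_of_isConj

theorem sign_auto (f : MulAut S6) (σ : S6) : sign (f σ) = sign σ := by
  have : (sign : S6 →* ℤˣ).comp f.toMonoidHom = sign := by
    apply eq_sign_of_surjective_hom
    exact (sign_surjective (Fin 6)).comp f.surjective
  exact DFunLike.congr_fun this σ

theorem keyP_pt (σ : S6) : keyP (pt σ) = (orderOf σ, sign σ) := by
  have h : (pt σ).parts.filter (2 ≤ ·) = σ.cycleType := filter_parts_partition_eq_cycleType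
  unfold keyP
  rw [h, lcm_cycleType, sign_of_cycleType]

theorem keyP_auto (f : MulAut S6) (σ : S6) : keyP (pt (f σ)) = keyP (pt σ) := by
  rw [keyP_pt, keyP_pt, sign_auto, MulEquiv.orderOf_eq]

theorem conj_auto (f : MulAut S6) {σ τ : S6} (h : IsConj σ τ) : IsConj (f σ) (f τ) :=
  MonoidHom.map_isConj f.toMonoidHom h

theorem amb_aux {ρ ρ' σ : S6} (h : Hrel ρ ρ') (hne : (pt ρ).parts ≠ (pt ρ').parts)
    (hσ : (pt σ).parts = (pt ρ).parts) : pt (phi σ) ≠ pt σ := by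
  intro he
  have h1 : IsConj σ ρ := pt_conj.2 (Nat.Partition.ext hσ)
  have h2 := pt_conj.1 (conj_auto phi h1)
  rw [phi_eq h, he] at h2
  rw [← h2, hσ] at hne
  exact hne rfl

theorem unamb_iff (σ : S6) : Unamb (pt σ) ↔ pt (phi σ) = pt σ := by
  constructor
  · intro h
    exact h _ (keyP_auto phi σ)
  · intro h q hq
    by_contra hne
    have p1 : (pt _).parts = _ := part1
    have p2 : (pt _).parts = _ := part2
    have p3 : (pt _).parts = _ := part3
    have p4 : (pt _).parts = _ := part4
    have p5 : (pt _).parts = _ := part5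
    have p6 : (pt _).parts = _ := part6
    have n1 : ({2,1,1,1,1} : Multiset ℕ) ≠ {2,2,2} := by decide
    have n2 : ({3,1,1,1} : Multiset ℕ) ≠ {3,3} := by decide
    have n3 : ({6} : Multiset ℕ) ≠ {3,2,1} := by decide
    rcases amb_list _ _ hq.symm (Ne.symm hne) with e | e | e | e | e | e
    · exact amb_aux h1 (by rw [p1, p2]; exact n1) (by rw [e, p1]) h
    · exact amb_aux (Hrel_symm h1) (by rw [p1, p2]; exact n1.symm) (by rw [e, p2]) h
    · exact amb_aux h33 (by rw [p3, p4]; exact n2) (by rw [e, p3]) h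
    · exact amb_aux (Hrel_symm h33) (by rw [p3, p4]; exact n2.symm) (by rw [e, p4]) h
    · exact amb_aux h66 (by rw [p5, p6]; exact n3) (by rw [e, p5]) h
    · exact amb_aux (Hrel_symm h66) (by rw [p5, p6]; exact n3.symm) (by rw [e, p6]) h

theorem key_conj {σ τ : S6} (h : keyP (pt σ) = keyP (pt τ)) :
    IsConj σ τ ∨ IsConj (phi σ) τ := by
  rw [pt_conj, pt_conj]
  by_cases he : pt σ = pt τ
  · exact Or.inl he
  right
  refine keyP_two (pt σ) (pt τ) _ h (keyP_auto phi σ) he ?_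
  rw [Ne, ← unamb_iff]
  intro hu
  exact he (hu _ h.symm).symm

theorem center6 : Subgroup.center S6 = ⊥ := center_perm 6 (by norm_num)

/-- Every automorphism is inner or inner times `phi`. -/
theorem auto_cases (f : MulAut S6) : ∃ g, f = MulAut.conj g ∨ f = MulAut.conj g * phi := by
  have hs : (swap 0 1 : S6).IsSwap := ⟨0, 1, by decide, rfl⟩
  have inner : ∀ f : MulAut S6, IsConj (f (swap 0 1)) (swap 0 1) → ∃ g, f = MulAut.conj g := by
    intro f hf
    refine inner_of_swaps (by norm_num) f ?_
    intro s hs'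
    have h1 := (conj_auto f (swap_isConj hs' hs)).trans hf
    rw [isConj_iff_cycleType_eq] at h1
    rw [isSwap_iff_cycleType, h1, ← isSwap_iff_cycleType]
    exact hs
  rcases key_conj (keyP_auto f (swap 0 1)) with h | h
  · obtain ⟨g, hg⟩ := inner f h
    exact ⟨g, Or.inl hg⟩
  · obtain ⟨g, hg⟩ := inner (phi * f) h
    refine ⟨phi g, Or.inr ?_⟩
    ext1 x
    have := DFunLike.congr_fun hg x
    simp only [MulAut.mul_apply, MulAut.conj_apply] at this ⊢
    rw [← phi_phi (f x), this]
    simp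

theorem phi_not_inner (g : S6) : MulAut.conj g ≠ phi := by
  intro h
  have h1 : pt (phi (swap 0 1)) = pt (swap 0 1) := by
    rw [← h, ← pt_conj]
    exact isConj_iff.2 ⟨g⁻¹, by simp [MulAut.conj_apply, mul_assoc]⟩
  have h2 := phi_eq VQ.h1
  rw [h2] at h1
  have p1 : (pt _).parts = _ := part1
  have p2 : (pt _).parts = _ := part2
  rw [Nat.Partition.ext_iff, p1, p2] at h1
  revert h1
  decide

end VQ

namespace VQ
open Equiv Equiv.Perm

section Burnside
variable {G : Type} [Group G]

/-- The group `G` with the `φ`-twisted conjugation action. -/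
def Tw (_φ : MulAut G) : Type := G

/-- Twisted conjugation. -/
def twa (φ : MulAut G) (τ σ : G) : G := τ * σ * (φ τ)⁻¹

theorem twa_one (φ : MulAut G) (σ : G) : twa φ 1 σ = σ := by simp [twa]

theorem twa_mul (φ : MulAut G) (a b σ : G) : twa φ (a * b) σ = twa φ a (twa φ b σ) := by
  simp [twa, mul_assoc]

instance (φ : MulAut G) : MulAction G (Tw φ) where
  smul τ σ := twa (G := G) φ τ σ
  one_smul σ := twa_one φ σ
  mul_smul a b σ := twa_mul φ a b σ

theorem tw_smul (φ : MulAut G) (τ σ : G) :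
    (τ • (show Tw φ from σ) : Tw φ) = (τ * σ * (φ τ)⁻¹ : G) := rfl

/-- Elements conjugate to their image under `φ`. -/
def Fc (φ : MulAut G) : Type := {τ : G // ∃ σ, τ * σ * (φ τ)⁻¹ = σ}

theorem fc_conj (φ : MulAut G) (g τ : G) (h : ∃ σ, τ * σ * (φ τ)⁻¹ = σ) :
    ∃ σ, (g * τ * g⁻¹) * σ * (φ (g * τ * g⁻¹))⁻¹ = σ := by
  obtain ⟨σ, h⟩ := h
  refine ⟨g * σ * (φ g)⁻¹, ?_⟩
  simp only [map_mul, map_inv]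
  conv_rhs => rw [← h]
  group

instance (φ : MulAut G) : MulAction G (Fc φ) where
  smul g τ := ⟨g * τ.1 * g⁻¹, fc_conj φ g τ.1 τ.2⟩
  one_smul τ := Subtype.ext (by change (1 : G) * τ.1 * 1⁻¹ = τ.1; simp)
  mul_smul a b τ := Subtype.ext (by
    change a * b * τ.1 * (a * b)⁻¹ = a * (b * τ.1 * b⁻¹) * a⁻¹
    group)

theorem fc_smul (φ : MulAut G) (g : G) (τ : Fc φ) : (g • τ).1 = g * τ.1 * g⁻¹ := rfl

theorem pair_aux (φ : MulAut G) (τ σ t : G) (h : τ * σ * (φ τ)⁻¹ = σ)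
    (h2 : τ * t * (φ τ)⁻¹ = t) : (σ * t⁻¹) * τ * (σ * t⁻¹)⁻¹ = τ := by
  have e1 : φ τ = t⁻¹ * τ * t := by
    rw [mul_inv_eq_iff_eq_mul] at h2; rw [mul_assoc, h2]; group
  have e2 : φ τ = σ⁻¹ * τ * σ := by
    rw [mul_inv_eq_iff_eq_mul] at h; rw [mul_assoc, h]; group
  have e3 : σ * t⁻¹ * τ * (σ * t⁻¹)⁻¹ = σ * (t⁻¹ * τ * t) * σ⁻¹ := by group
  rw [e3, ← e1, e2]
  group

theorem pairs_equiv (φ : MulAut G) :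
    Nonempty ({ab : G × Tw φ // ab.1 • ab.2 = ab.2} ≃ {ab : G × Fc φ // ab.1 • ab.2 = ab.2}) := by
  choose s hs using (fun τ : Fc φ => τ.2)
  refine ⟨⟨fun x => ⟨((show G from x.1.2) * (s ⟨x.1.1, _, x.2⟩)⁻¹, ⟨x.1.1, _, x.2⟩), ?_⟩,
    fun y => ⟨(y.1.2.1, (y.1.1 * s y.1.2 : G)), ?_⟩, ?_, ?_⟩⟩
  · obtain ⟨⟨τ, σ⟩, h⟩ := x
    exact Subtype.ext (pair_aux φ τ σ _ h (hs ⟨τ, _, h⟩))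
  · obtain ⟨⟨g, τ⟩, h⟩ := y
    have h2 := hs τ
    have h' : g * τ.1 * g⁻¹ = τ.1 := congrArg Subtype.val h
    change τ.1 * (g * s τ) * (φ τ.1)⁻¹ = g * s τ
    rw [mul_inv_eq_iff_eq_mul] at h'
    rw [← mul_assoc, ← h', mul_assoc, mul_assoc, ← mul_assoc τ.1, h2]
  · rintro ⟨⟨τ, σ⟩, h⟩
    refine Subtype.ext (Prod.ext rfl ?_)
    exact inv_mul_cancel_right (G := G) σ _
  · rintro ⟨⟨g, τ⟩, h⟩
    refine Subtype.ext (Prod.ext ?_ rfl)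
    change g * s τ * (s τ)⁻¹ = g
    simp

theorem burnside (φ : MulAut G) [Finite G] :
    Nat.card (MulAction.orbitRel.Quotient G (Tw φ)) =
      Nat.card (MulAction.orbitRel.Quotient G (Fc φ)) := by
  obtain ⟨e⟩ := pairs_equiv φ
  have e1 := (Equiv.subtypeProdEquivSigmaSubtype
    (fun (a : G) (b : Tw φ) => a • b = b)).trans
    (MulAction.sigmaFixedByEquivOrbitsProdGroup G (Tw φ))
  have e2 := (Equiv.subtypeProdEquivSigmaSubtype
    (fun (a : G) (b : Fc φ) => a • b = b)).trans
    (MulAction.sigmaFixedByEquivOrbitsProdGroup G (Fc φ))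
  have h := Nat.card_congr (e1.symm.trans (e.trans e2))
  rw [Nat.card_prod, Nat.card_prod] at h
  exact Nat.eq_of_mul_eq_mul_right Nat.card_pos h

end Burnside

theorem fc_iff (τ : S6) : (∃ σ, τ * σ * (phi τ)⁻¹ = σ) ↔ Unamb (pt τ) := by
  rw [unamb_iff, ← pt_conj, isConj_iff]
  refine exists_congr fun σ => ?_
  constructor
  · intro h
    rw [mul_inv_eq_iff_eq_mul] at h
    rw [← h]; group
  · intro h
    rw [mul_inv_eq_iff_eq_mul] at h
    rw [mul_inv_eq_iff_eq_mul, h]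

theorem card_fc : Nat.card (MulAction.orbitRel.Quotient S6 (Fc phi)) = 5 := by
  rw [← card_unamb]
  refine card_eq_of_surj (X := Fc phi) (fun τ => Quotient.mk _ τ)
    (fun τ => ⟨pt τ.1, (fc_iff _).1 τ.2⟩) Quotient.mk_surjective ?_ ?_
  · rintro ⟨p, hp⟩
    obtain ⟨σ, rfl⟩ := pt_surj p
    exact ⟨⟨σ, (fc_iff _).2 hp⟩, rfl⟩
  · intro x y
    rw [Subtype.ext_iff]
    change _ ↔ pt x.1 = pt y.1
    rw [← pt_conj, isConj_comm, isConj_iff, Quotient.eq]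
    change (∃ g, g • y = x) ↔ _
    exact exists_congr fun g => Subtype.ext_iff

theorem card_tw : Nat.card (MulAction.orbitRel.Quotient S6 (Tw phi)) = 5 :=
  (burnside phi).trans card_fc

theorem conj_conj (c : MulAut S6) (σ : S6) :
    c * MulAut.conj σ * c⁻¹ = MulAut.conj (c σ) := by
  ext1 x
  simp [MulAut.conj_apply]

theorem phi_mul_phi : phi * phi = 1 := by
  ext1 x; exact phi_phi x

theorem phi_inv : phi⁻¹ = phi := inv_eq_of_mul_eq_one_left phi_mul_phi

theorem conj_ctw (τ σ : S6) : MulAut.conj τ * (MulAut.conj σ * phi) * (MulAut.conj τ)⁻¹ =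
    MulAut.conj (τ * σ * (phi τ)⁻¹) * phi := by
  ext1 x
  simp [MulAut.conj_apply, mul_assoc]

theorem conj_ctw_phi (σ : S6) : phi * (MulAut.conj σ * phi) * phi⁻¹ =
    MulAut.conj (σ⁻¹ * σ * (phi σ⁻¹)⁻¹) * phi := by
  ext1 x
  simp [MulAut.conj_apply, mul_assoc]

theorem tw_conj (σ σ' : S6) : IsConj (MulAut.conj σ * phi) (MulAut.conj σ' * phi) ↔
    ∃ τ : S6, τ * σ * (phi τ)⁻¹ = σ' := by
  have inj : ∀ a b : S6, MulAut.conj a * phi = MulAut.conj b * phi → a = b :=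
    fun a b h => center_inj center6 (mul_right_cancel h)
  constructor
  · rw [isConj_iff]
    rintro ⟨c, hc⟩
    obtain ⟨τ, rfl | rfl⟩ := auto_cases c
    · rw [conj_ctw] at hc
      exact ⟨τ, inj _ _ hc⟩
    · have : MulAut.conj τ * (phi * (MulAut.conj σ * phi) * phi⁻¹) * (MulAut.conj τ)⁻¹ =
          MulAut.conj σ' * phi := by rw [← hc]; group
      rw [conj_ctw_phi, conj_ctw] at this
      refine ⟨τ * σ⁻¹, ?_⟩
      rw [← inj _ _ this]
      simp [mul_assoc]
  · rintro ⟨τ, rfl⟩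
    exact isConj_iff.2 ⟨MulAut.conj τ, conj_ctw τ σ⟩

theorem in_conj (σ σ' : S6) : IsConj (MulAut.conj σ) (MulAut.conj σ') ↔
    keyP (pt σ) = keyP (pt σ') := by
  constructor
  · rw [isConj_iff]
    rintro ⟨c, hc⟩
    rw [conj_conj] at hc
    rw [← center_inj center6 hc, keyP_auto]
  · intro h
    rcases key_conj h with h | h
    · obtain ⟨g, rfl⟩ := isConj_iff.1 h
      exact isConj_iff.2 ⟨MulAut.conj g, by rw [conj_conj]; rfl⟩
    · obtain ⟨g, rfl⟩ := isConj_iff.1 h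
      exact isConj_iff.2 ⟨MulAut.conj g * phi, by rw [conj_conj]; rfl⟩

theorem not_conj (σ σ' : S6) : ¬ IsConj (MulAut.conj σ) (MulAut.conj σ' * phi) := by
  rw [isConj_iff]
  rintro ⟨c, hc⟩
  rw [conj_conj] at hc
  refine phi_not_inner (σ'⁻¹ * c σ) ?_
  rw [map_mul, hc, map_inv]
  group

theorem card_six : Nat.card (ConjClasses (MulAut S6)) = 13 := by
  have h : Nat.card (ConjClasses (MulAut S6)) =
      Nat.card (Set.range keyP ⊕ MulAction.orbitRel.Quotient S6 (Tw phi)) := by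
    refine card_eq_of_surj (X := S6 ⊕ S6)
      (Sum.elim (fun σ => ConjClasses.mk (MulAut.conj σ))
        (fun σ => ConjClasses.mk (MulAut.conj σ * phi)))
      (Sum.elim (fun σ => Sum.inl ⟨keyP (pt σ), _, rfl⟩)
        (fun σ => Sum.inr (Quotient.mk _ (show Tw phi from σ)))) ?_ ?_ ?_
    · intro c
      obtain ⟨f, rfl⟩ := ConjClasses.exists_rep c
      obtain ⟨g, rfl | rfl⟩ := auto_cases f
      · exact ⟨Sum.inl g, rfl⟩
      · exact ⟨Sum.inr g, rfl⟩
    · rintro (⟨_, p, rfl⟩ | q)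
      · obtain ⟨σ, rfl⟩ := pt_surj p
        exact ⟨Sum.inl σ, rfl⟩
      · obtain ⟨σ, rfl⟩ := Quotient.mk_surjective q
        exact ⟨Sum.inr σ, rfl⟩
    · rintro (σ | σ) (σ' | σ')
      · simp only [Sum.elim_inl, ConjClasses.mk_eq_mk_iff_isConj, in_conj, Sum.inl.injEq]
        exact ⟨fun h => Subtype.ext h, fun h => congrArg Subtype.val h⟩
      · simp only [Sum.elim_inl, Sum.elim_inr, ConjClasses.mk_eq_mk_iff_isConj, not_conj,
          reduceCtorEq]
      · simp only [Sum.elim_inl, Sum.elim_inr, ConjClasses.mk_eq_mk_iff_isConj, reduceCtorEq,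
          iff_false]
        exact fun h => not_conj _ _ h.symm
      · simp only [Sum.elim_inr, ConjClasses.mk_eq_mk_iff_isConj, Sum.inr.injEq]
        rw [isConj_comm, tw_conj]
        exact (Quotient.eq (r := MulAction.orbitRel S6 (Tw phi)) (x := σ) (y := σ')).symm
  have f1 : Finite (Set.range keyP) := Nat.finite_of_card_ne_zero (by rw [card_keyP]; norm_num)
  have f2 : Finite (MulAction.orbitRel.Quotient S6 (Tw phi)) :=
    Nat.finite_of_card_ne_zero (by rw [card_tw]; norm_num)
  rw [h, Nat.card_sum, card_keyP, card_tw]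

end VQ

/-- The number of isomorphism classes of virtual quandles whose underlying quandle is the
conjugation quandle of the symmetric group `S_n` equals `p(n)` for `n ≠ 6`, and `13` for
`n = 6`. -/
theorem stmt_11 (n : ℕ) (hn : 0 < n) :
    (n ≠ 6 → Nat.card (VirtualClasses (conjS (Equiv.Perm (Fin n)))) =
      Fintype.card (Nat.Partition n)) ∧
    (n = 6 → Nat.card (VirtualClasses (conjS (Equiv.Perm (Fin n)))) = 13) := by
  constructor
  · intro h6
    by_cases h3 : 3 ≤ n
    · exact VQ.main_ne_six n h3 h6
    · exact VQ.main_small n (by omega)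
  · rintro rfl
    rw [VQ.card_virt VQ.center6]
    exact VQ.card_six
end

section
/- Let n be a positive integer and let A_n be the alternating group on n letters. Then the number of isomorphism classes of virtual quandles whose underlying quandle is the conjugation quandle Conj(A_n) equals p(n) if n ∉ {2, 6}, equals 1 if n = 2, and equals 13 if n = 6, where p(n) denotes the number of partitions of n. -/
open Equiv Equiv.Perm

namespace VQ

theorem card_virtual {X H : Type*} [Group H] (s : X → Equiv.Perm X) (φ : H → RackAut s)
    (hφ : Function.Bijective φ) (hm : ∀ a b, (φ (a * b)).1 = (φ a).1 * (φ b).1) :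
    Nat.card (VirtualClasses s) = Nat.card (ConjClasses H) := by
  have hinj : ∀ a b, (φ a).1 = (φ b).1 → a = b := fun a b h => hφ.1 (Subtype.ext h)
  have key : ∀ a b : H, VirtIso s (φ a) (φ b) ↔ IsConj a b := by
    intro a b
    rw [isConj_iff]
    constructor
    · rintro ⟨ψ, h⟩
      obtain ⟨c, rfl⟩ := hφ.2 ψ
      refine ⟨c, ?_⟩
      rw [← hm, ← hm] at h
      rw [hinj _ _ h]; group
    · rintro ⟨c, rfl⟩
      refine ⟨φ c, ?_⟩
      rw [← hm, ← hm]; congr 2; group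
  refine (Nat.card_congr (Equiv.ofBijective
    (Quot.lift (fun a : H => (Quot.mk _ (φ a) : VirtualClasses s))
      (fun a b h => Quot.sound ((key a b).2 h))) ⟨?_, ?_⟩)).symm
  · rintro ⟨a⟩ ⟨b⟩ h
    have h1 : Relation.EqvGen (VirtIso s) (φ a) (φ b) := Quot.eqvGen_exact h
    have h2 : Equivalence (VirtIso s) := by
      refine ⟨fun x => ?_, fun {x y} hxy => ?_, fun {x y z} hxy hyz => ?_⟩
      · obtain ⟨a, rfl⟩ := hφ.2 x
        exact (key _ _).2 (IsConj.refl _)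
      · obtain ⟨a, rfl⟩ := hφ.2 x
        obtain ⟨b, rfl⟩ := hφ.2 y
        exact (key _ _).2 ((key _ _).1 hxy).symm
      · obtain ⟨a, rfl⟩ := hφ.2 x
        obtain ⟨b, rfl⟩ := hφ.2 y
        obtain ⟨c, rfl⟩ := hφ.2 z
        exact (key _ _).2 (((key _ _).1 hxy).trans ((key _ _).1 hyz))
    exact Quot.sound ((key a b).1 (h2.eqvGen_iff.1 h1))
  · rintro ⟨x⟩
    obtain ⟨a, rfl⟩ := hφ.2 x
    exact ⟨Quot.mk _ a, rfl⟩

theorem card_virtual_comm (G : Type*) [Group G] (hG : ∀ a b : G, a * b = b * a) :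
    Nat.card (VirtualClasses (conjS G)) = Nat.card (ConjClasses (Perm G)) := by
  have hs : ∀ x y : G, conjS G x y = y := by
    intro x y
    change x * y * x⁻¹ = y
    rw [hG x y]; group
  refine card_virtual (conjS G) (fun f => ⟨f, fun x y => by rw [hs, hs]⟩) ⟨?_, ?_⟩ ?_
  · intro f g h
    exact congrArg Subtype.val h
  · intro f
    exact ⟨f.1, rfl⟩
  · intro a b; rfl

theorem card_virtual_center (G : Type*) [Group G] (hG : Subgroup.center G = ⊥) :
    Nat.card (VirtualClasses (conjS G)) = Nat.card (ConjClasses (MulAut G)) := by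
  refine card_virtual (conjS G) (fun f => ⟨f.toEquiv, fun x y => ?_⟩) ⟨?_, ?_⟩ ?_
  · change f (x * y * x⁻¹) = f x * f y * (f x)⁻¹
    simp
  · intro f g h
    have := congrArg Subtype.val h
    ext x
    exact DFunLike.congr_fun this x
  · intro f
    have hf : ∀ x y, f.1 (x * y * x⁻¹) = f.1 x * f.1 y * (f.1 x)⁻¹ := f.2
    refine ⟨MulEquiv.mk f.1 ?_, rfl⟩
    intro x y
    change f.1 (x * y) = f.1 x * f.1 y
    have h1 : (f.1 x * f.1 y)⁻¹ * f.1 (x * y) ∈ Subgroup.center G := by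
      rw [Subgroup.mem_center_iff]
      intro g
      obtain ⟨z, rfl⟩ := f.1.surjective g
      have e1 : f.1 (x * y) * f.1 z * (f.1 (x * y))⁻¹
          = f.1 x * (f.1 y * f.1 z * (f.1 y)⁻¹) * (f.1 x)⁻¹ := by
        rw [← hf, ← hf, ← hf]; congr 1; group
      have e2 : f.1 (x * y) * f.1 z
          = f.1 x * (f.1 y * f.1 z * (f.1 y)⁻¹) * (f.1 x)⁻¹ * f.1 (x * y) := by
        rw [← e1]; group
      rw [mul_assoc _ _ (f.1 z), e2]; group
    rw [hG, Subgroup.mem_bot, inv_mul_eq_one] at h1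
    exact h1.symm
  · intro a b; rfl

theorem card_conjClasses_perm (α : Type*) [Fintype α] [DecidableEq α] :
    Nat.card (ConjClasses (Perm α)) = Fintype.card (Nat.Partition (Fintype.card α)) := by
  rw [← Nat.card_eq_fintype_card]
  refine Nat.card_congr (Equiv.ofBijective
    (Quot.lift (fun σ : Perm α => σ.partition) (fun a b h => partition_eq_of_isConj.1 h)) ⟨?_, ?_⟩)
  · rintro ⟨a⟩ ⟨b⟩ h
    exact Quot.sound (partition_eq_of_isConj.2 h)
  · intro p
    have hm : ((p.parts.filter (2 ≤ ·)).sum ≤ Fintype.card α ∧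
        ∀ a ∈ p.parts.filter (2 ≤ ·), 2 ≤ a) := by
      refine ⟨?_, fun a ha => (Multiset.mem_filter.1 ha).2⟩
      obtain ⟨u, hu⟩ := Multiset.le_iff_exists_add.1 (Multiset.filter_le (2 ≤ ·) p.parts)
      have h0 := congrArg Multiset.sum hu
      rw [Multiset.sum_add, p.parts_sum] at h0
      omega
    obtain ⟨σ, hσ⟩ := (exists_with_cycleType_iff α).2 hm
    refine ⟨Quot.mk _ σ, ?_⟩
    change σ.partition = p
    ext1
    rw [parts_partition, ← sum_cycleType, hσ]
    have h1 : p.parts.filter (2 ≤ ·) + p.parts.filter (fun a => ¬ 2 ≤ a) = p.parts :=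
      Multiset.filter_add_not _ _
    have h2 : p.parts.filter (fun a => ¬ 2 ≤ a) =
        Multiset.replicate (Multiset.card (p.parts.filter (fun a => ¬ 2 ≤ a))) 1 := by
      rw [Multiset.eq_replicate_card]
      intro b hb
      have := Multiset.mem_filter.1 hb
      have := p.parts_pos this.1
      omega
    conv_rhs => rw [← h1]
    congr 1
    rw [h2]
    congr 1
    have h3 := congrArg Multiset.sum h1
    rw [p.parts_sum, h2, Multiset.sum_add, Multiset.sum_replicate] at h3
    simp only [smul_eq_mul, mul_one] at h3
    omega

theorem small_case (n : ℕ) (hn : n ≤ 3) :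
    Nat.card (VirtualClasses (conjS (alternatingGroup (Fin n)))) =
      Fintype.card (Nat.Partition (Fintype.card (alternatingGroup (Fin n)))) := by
  have := (alternatingGroup.isMulCommutative_of_card_le_three (α := Fin n) (by simpa using hn))
  rw [card_virtual_comm _ (fun a b => this.is_comm.comm a b), card_conjClasses_perm]

theorem part_one : Fintype.card (Nat.Partition 1) = 1 := by decide

end VQ
namespace VQ
section
set_option linter.unusedSectionVars false
set_option linter.unusedFintypeInType false
set_option linter.unusedDecidableInType false
variable {α : Type*} [Fintype α] [DecidableEq α]

/-- `x` is the three-cycle `a → b → c → a`. -/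
structure Tri (x : Perm α) (a b c : α) : Prop where
  ab : a ≠ b
  ac : a ≠ c
  bc : b ≠ c
  xa : x a = b
  xb : x b = c
  xc : x c = a
  fix : ∀ t, t ≠ a → t ≠ b → t ≠ c → x t = t

theorem Tri.rot {x : Perm α} {a b c : α} (h : Tri x a b c) : Tri x b c a :=
  ⟨h.bc, h.ab.symm, h.ac.symm, h.xb, h.xc, h.xa, fun t h1 h2 h3 => h.fix t h3 h1 h2⟩

theorem tri_of {x : Perm α} (h : x.IsThreeCycle) (a : α) (ha : x a ≠ a) :
    Tri x a (x a) (x (x a)) := by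
  have h1 := h.nodup_iff_mem_support.2 (mem_support.2 ha)
  have h2 := h.support_eq_iff_mem_support.2 (mem_support.2 ha)
  simp only [List.nodup_cons, List.mem_cons, List.not_mem_nil, or_false, not_or] at h1
  refine ⟨h1.1.1, h1.1.2, h1.2.1, rfl, rfl, ?_, ?_⟩
  · have : (x ^ 3) a = a := by rw [← h.orderOf, pow_orderOf_eq_one]; rfl
    simpa [pow_succ] using this
  · intro t h3 h4 h5
    have : t ∉ x.support := by
      rw [h2]; simp [h3, h4, h5]
    simpa using this

theorem exists_tri {x : Perm α} (h : x.IsThreeCycle) : ∃ a b c, Tri x a b c := by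
  have : x ≠ 1 := h.ne_one
  obtain ⟨a, ha⟩ : ∃ a, x a ≠ a := by
    by_contra! hc
    exact this (Equiv.ext hc)
  exact ⟨_, _, _, tri_of h a ha⟩

theorem Tri.eq {x y : Perm α} {a b c : α} (h : Tri x a b c) (h' : Tri y a b c) : x = y := by
  ext t
  have := h.xa; have := h.xb; have := h.xc; have := h.fix t
  have := h'.xa; have := h'.xb; have := h'.xc; have := h'.fix t
  by_cases h1 : t = a
  · subst h1; simp_all
  by_cases h2 : t = b
  · subst h2; simp_all
  by_cases h3 : t = c
  · subst h3; simp_all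
  simp_all

/-- the three-cycle `a → b → c → a`. -/
def cyc (a b c : α) : Perm α := swap a b * swap b c

theorem tri_cyc {a b c : α} (ab : a ≠ b) (ac : a ≠ c) (bc : b ≠ c) : Tri (cyc a b c) a b c := by
  constructor <;> simp [cyc, swap_apply_def] <;> grind

theorem cyc_three {a b c : α} (ab : a ≠ b) (ac : a ≠ c) (bc : b ≠ c) :
    (cyc a b c).IsThreeCycle := by
  have := isThreeCycle_swap_mul_swap_same ab.symm bc ac
  rwa [swap_comm b a] at this

set_option maxHeartbeats 2000000 in
theorem edge {x y : Perm α} {a b c d e f : α} (hx : Tri x a b c) (hy : Tri y d e f)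
    (h2 : ∀ t, x (y (x (y t))) = t) (h1 : ∃ t, x (y t) ≠ t) : ∃ t, x t = y t ∧ x t ≠ t := by
  have hn : ¬ (y a = c ∧ y c = b ∧ y b = a) := by
    rintro ⟨h3, h4, h5⟩
    obtain ⟨t, ht⟩ := h1
    have f1 := hx.xa
    have f2 := hx.xb
    have f3 := hx.xc
    by_cases t1 : t = a
    · subst t1; simp_all
    by_cases t2 : t = b
    · subst t2; simp_all
    by_cases t3 : t = c
    · subst t3; simp_all
    have u1 : y t ≠ a := fun h => t2 (y.injective (h.trans h5.symm))
    have u2 : y t ≠ b := fun h => t3 (y.injective (h.trans h4.symm))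
    have u3 : y t ≠ c := fun h => t1 (y.injective (h.trans h3.symm))
    rw [hx.fix _ u1 u2 u3] at ht
    have := hy.fix t
    have := hy.fix a
    have := hy.fix b
    have := hy.fix c
    have := hx.ab
    have := hx.bc
    have := hx.ac
    have : a = d ∨ a = e ∨ a = f := by grind
    have : b = d ∨ b = e ∨ b = f := by grind
    have : c = d ∨ c = e ∨ c = f := by grind
    grind
  clear h1
  by_contra! hc
  have := hc a
  have := hc b
  have := hc c
  have := h2 a
  have := h2 b
  have := h2 c
  have := h2 d
  have := h2 e
  have := h2 f
  obtain ⟨x1, x2, x3, x4, x5, x6, x7⟩ := hx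
  obtain ⟨y1, y2, y3, y4, y5, y6, y7⟩ := hy
  have := x7 d
  have := x7 e
  have := x7 f
  have := y7 a
  have := y7 b
  have := y7 c
  clear h2 hc x7 y7
  have hd : d = a ∨ d = b ∨ d = c ∨ (d ≠ a ∧ d ≠ b ∧ d ≠ c) := by
    clear * -
    tauto
  have he : e = a ∨ e = b ∨ e = c ∨ (e ≠ a ∧ e ≠ b ∧ e ≠ c) := by
    clear * -
    tauto
  have hf : f = a ∨ f = b ∨ f = c ∨ (f ≠ a ∧ f ≠ b ∧ f ≠ c) := by
    clear * -
    tauto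
  rcases hd with h1 | h1 | h1 | h1 <;> rcases he with h2 | h2 | h2 | h2 <;>
    rcases hf with h3 | h3 | h3 | h3 <;> grind

theorem edge2 {x y z : Perm α} {a b c d : α} (hx : Tri x a b c) (hy : Tri y a b d) (hcd : c ≠ d)
    (hz : ∀ t, z t ≠ t → Tri z t (z t) (z (z t)))
    (h1 : ∃ t, z t = x t ∧ z t ≠ t) (h2 : ∃ t, z t = y t ∧ z t ≠ t) : z a = b := by
  obtain ⟨t, h3, h4⟩ := h1
  obtain ⟨u, h5, h6⟩ := h2
  have hz1 := hz t h4
  have hz2 := hz u h6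
  obtain ⟨x1, x2, x3, x4, x5, x6, x7⟩ := hx
  obtain ⟨y1, y2, y3, y4, y5, y6, y7⟩ := hy
  obtain ⟨-, -, -, -, -, z6, z7⟩ := hz1
  have ht : t = a ∨ t = b ∨ t = c := by grind
  have hu : u = a ∨ u = b ∨ u = d := by grind
  rcases ht with rfl | rfl | rfl <;> rcases hu with rfl | rfl | rfl <;> grind

theorem all_cyc (M : Subgroup (Perm α)) {p q : α} (pq : p ≠ q)
    (h : ∀ i, i ≠ p → i ≠ q → cyc p q i ∈ M) (a b c : α) (ab : a ≠ b) (ac : a ≠ c) (bc : b ≠ c) :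
    cyc a b c ∈ M := by
  have rot : ∀ a b c : α, a ≠ b → a ≠ c → b ≠ c → cyc a b c = cyc b c a := by
    intro a b c ab ac bc
    exact (tri_cyc ab ac bc).rot.eq (tri_cyc bc ab.symm ac.symm)
  have inv : ∀ a b c : α, a ≠ b → a ≠ c → b ≠ c → (cyc a b c)⁻¹ = cyc a c b := by
    intro a b c ab ac bc
    rw [inv_eq_iff_mul_eq_one]
    ext t
    simp [cyc, swap_apply_def]; grind
  have hp : ∀ b c : α, p ≠ b → p ≠ c → b ≠ c → cyc p b c ∈ M := by
    intro b c pb pc bc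
    by_cases hb : b = q
    · subst hb; exact h c pc.symm bc.symm
    by_cases hc : c = q
    · subst hc
      rw [← inv p c b pc pb bc.symm]
      exact M.inv_mem (h b pb.symm bc)
    have : cyc p b c = cyc p q c * (cyc p q b)⁻¹ := by
      rw [inv p q b pq pb (Ne.symm hb)]
      ext t
      simp [cyc, swap_apply_def]; grind
    rw [this]
    exact M.mul_mem (h _ pc.symm hc) (M.inv_mem (h _ pb.symm hb))
  by_cases h1 : a = p
  · subst h1; exact hp b c ab ac bc
  by_cases h2 : b = p
  · subst h2; rw [rot a b c ab ac bc]; exact hp _ _ bc ab.symm ac.symm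
  by_cases h3 : c = p
  · subst h3; rw [← rot c a b ac.symm bc.symm ab]; exact hp _ _ ac.symm bc.symm ab
  have : cyc a b c = cyc p a b * cyc p b c := by
    ext t
    simp [cyc, swap_apply_def]; grind
  rw [this]
  exact M.mul_mem (hp _ _ (Ne.symm h1) (Ne.symm h2) ab) (hp _ _ (Ne.symm h2) (Ne.symm h3) bc)

end
end VQ
namespace VQ
section
variable {α : Type*} [Fintype α] [DecidableEq α]

theorem conj_of_three (hα : 4 ≤ Fintype.card α) (f : MulAut (alternatingGroup α))
    (hf : ∀ x : alternatingGroup α, (x : Perm α).IsThreeCycle → (f x : Perm α).IsThreeCycle) :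
    ∃ σ : Perm α, MulAut.conjNormal σ = f := by
  obtain ⟨s, hs⟩ : ∃ s : Fin 4 → α, Function.Injective s := by
    have : Nonempty (Fin 4 ↪ α) := Function.Embedding.nonempty_of_card_le (by simpa using hα)
    exact ⟨this.some, this.some.injective⟩
  obtain ⟨p, q, i, j, pq, pi, pj, qi, qj, ij⟩ : ∃ p q i j : α, p ≠ q ∧ p ≠ i ∧ p ≠ j ∧
      q ≠ i ∧ q ≠ j ∧ i ≠ j := by
    refine ⟨s 0, s 1, s 2, s 3, ?_, ?_, ?_, ?_, ?_, ?_⟩ <;> exact fun h => by simpa using hs h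
  -- the generators
  let X : {k : α // k ≠ p ∧ k ≠ q} → alternatingGroup α := fun k =>
    ⟨cyc p q k, (cyc_three pq k.2.1.symm k.2.2.symm).mem_alternatingGroup⟩
  have hX : ∀ k, Tri (X k : Perm α) p q k := fun k => tri_cyc pq k.2.1.symm k.2.2.symm
  have hX3 : ∀ k, (X k : Perm α).IsThreeCycle := fun k => cyc_three pq k.2.1.symm k.2.2.symm
  have hY3 : ∀ k, (f (X k) : Perm α).IsThreeCycle := fun k => hf _ (hX3 k)
  have hXinj : ∀ k l, X k = X l → k = l := by
    intro k l h
    have h1 := (hX k).xb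
    have h2 := (hX l).xb
    rw [h] at h1
    exact Subtype.ext (h1.symm.trans h2)
  have hedge : ∀ k l, k ≠ l → ∃ t, (f (X k) : Perm α) t = (f (X l) : Perm α) t ∧
      (f (X k) : Perm α) t ≠ t := by
    intro k l hkl
    obtain ⟨a, b, c, hk⟩ := exists_tri (hY3 k)
    obtain ⟨d, e, g, hl⟩ := exists_tri (hY3 l)
    have hkl' : (k : α) ≠ l := fun h => hkl (Subtype.ext h)
    have h2 : X k * X l * (X k * X l) = 1 := by
      ext t
      have h1 := hX k
      have h2 := hX l
      obtain ⟨x1, x2, x3, x4, x5, x6, x7⟩ := h1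
      obtain ⟨y1, y2, y3, y4, y5, y6, y7⟩ := h2
      change (X k : Perm α) ((X l : Perm α) ((X k : Perm α) ((X l : Perm α) t))) = t
      by_cases t1 : t = p
      · rw [t1, y4, x5, y7 _ x2.symm x3.symm hkl', x6]
      by_cases t2 : t = q
      · rw [t2, y5, x7 _ y2.symm y3.symm hkl'.symm, y6, x4]
      by_cases t3 : t = k
      · rw [t3, y7 _ x2.symm x3.symm hkl', x6, y4, x5]
      by_cases t4 : t = l
      · rw [t4, y6, x4, y5, x7 _ y2.symm y3.symm hkl'.symm]
      rw [y7 t t1 t2 t4, x7 t t1 t2 t3, y7 t t1 t2 t4, x7 t t1 t2 t3]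
    have h2' : f (X k) * f (X l) * (f (X k) * f (X l)) = 1 := by
      rw [← map_mul, ← map_mul, h2, map_one]
    refine edge hk hl ?_ ?_
    · intro t
      exact congrArg (fun z : alternatingGroup α => (z : Perm α) t) h2'
    · by_contra! hc
      have : f (X k) * f (X l) = 1 := by
        ext t; exact hc t
      rw [← map_mul, map_eq_one_iff _ f.injective] at this
      have h3 := congrArg (fun z : alternatingGroup α => (z : Perm α) q) this
      change (X k : Perm α) ((X l : Perm α) q) = q at h3
      have hl' := hX l
      rw [hl'.xb, (hX k).fix _ hl'.ac.symm hl'.bc.symm hkl'.symm] at h3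
      exact hl'.bc h3.symm
  let ki : {k : α // k ≠ p ∧ k ≠ q} := ⟨i, pi.symm, qi.symm⟩
  let kj : {k : α // k ≠ p ∧ k ≠ q} := ⟨j, pj.symm, qj.symm⟩
  have hij : ki ≠ kj := fun h => ij (congrArg Subtype.val h)
  obtain ⟨a, h1, h2⟩ := hedge ki kj hij
  have ti := tri_of (hY3 ki) a h2
  have tj := tri_of (hY3 kj) a (h1 ▸ h2)
  rw [← h1] at tj
  set b := (f (X ki) : Perm α) a with hb
  have hcd : (f (X ki) : Perm α) b ≠ (f (X kj) : Perm α) b := by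
    intro h
    rw [← h] at tj
    exact hij (hXinj _ _ (f.injective (Subtype.ext (ti.eq tj))))
  have hall : ∀ k, (f (X k) : Perm α) a = b := by
    intro k
    by_cases k1 : k = ki
    · rw [k1]
    by_cases k2 : k = kj
    · rw [k2, ← h1]
    exact edge2 ti tj hcd (fun t ht => tri_of (hY3 k) t ht) (hedge k ki k1) (hedge k kj k2)
  have hab : a ≠ b := ti.ab
  have htri : ∀ k, Tri (f (X k) : Perm α) a b ((f (X k) : Perm α) b) := by
    intro k
    have := tri_of (hY3 k) a (by rw [hall]; exact hab.symm)
    rwa [hall] at this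
  -- the permutation
  let g : α → α := fun k => if hk : k ≠ p ∧ k ≠ q then (f (X ⟨k, hk⟩) : Perm α) b
    else if k = p then a else b
  have gp : g p = a := by simp [g]
  have gq : g q = b := by simp [g, pq.symm]
  have gk : ∀ k : {k : α // k ≠ p ∧ k ≠ q}, g k = (f (X k) : Perm α) b := by
    intro k
    simp only [g]
    rw [dif_pos k.2]
  have ginj : Function.Injective g := by
    have key : ∀ k l : {k : α // k ≠ p ∧ k ≠ q}, g k = g l → k = l := by
      intro k l h
      rw [gk, gk] at h
      have h3 := htri k
      rw [h] at h3
      exact hXinj _ _ (f.injective (Subtype.ext (h3.eq (htri l))))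
    have ga : ∀ k : {k : α // k ≠ p ∧ k ≠ q}, g k ≠ a ∧ g k ≠ b := by
      intro k
      rw [gk]
      exact ⟨(htri k).ac.symm, (htri k).bc.symm⟩
    have hsp : ∀ k, k = p ∨ k = q ∨ ∃ k' : {k : α // k ≠ p ∧ k ≠ q}, (k' : α) = k := by
      intro k
      by_cases k1 : k = p
      · exact Or.inl k1
      by_cases k2 : k = q
      · exact Or.inr (Or.inl k2)
      exact Or.inr (Or.inr ⟨⟨k, k1, k2⟩, rfl⟩)
    intro k l h
    rcases hsp k with hk | hk | ⟨k', hk⟩ <;> rcases hsp l with hl | hl | ⟨l', hl⟩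
    · rw [hk, hl]
    · rw [hk, hl, gp, gq] at h; exact absurd h hab
    · rw [hk, ← hl, gp] at h; exact absurd h.symm (ga l').1
    · rw [hk, hl, gp, gq] at h; exact absurd h.symm hab
    · rw [hk, hl]
    · rw [hk, ← hl, gq] at h; exact absurd h.symm (ga l').2
    · rw [← hk, hl, gp] at h; exact absurd h (ga k').1
    · rw [← hk, hl, gq] at h; exact absurd h (ga k').2
    · rw [← hk, ← hl] at h ⊢; rw [key _ _ h]
  let σ : Perm α := Equiv.ofBijective g (Finite.injective_iff_bijective.1 ginj)
  have hσ : ∀ t, σ t = g t := fun t => rfl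
  refine ⟨σ, ?_⟩
  have hgen : ∀ k, MulAut.conjNormal σ (X k) = f (X k) := by
    intro k
    apply Subtype.ext
    rw [MulAut.conjNormal_apply]
    refine Tri.eq (a := a) (b := b) (c := g k) ?_ (by rw [gk]; exact htri k)
    have hk := hX k
    have sp : σ⁻¹ a = p := by rw [Perm.inv_eq_iff_eq, hσ, gp]
    have sq : σ⁻¹ b = q := by rw [Perm.inv_eq_iff_eq, hσ, gq]
    have sk : σ⁻¹ (g k) = k := by rw [Perm.inv_eq_iff_eq, hσ]
    refine ⟨hab, ?_, ?_, ?_, ?_, ?_, ?_⟩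
    · rw [gk]; exact (htri k).ac
    · rw [gk]; exact (htri k).bc
    · rw [Perm.mul_apply, Perm.mul_apply, sp, hk.xa, hσ, gq]
    · rw [Perm.mul_apply, Perm.mul_apply, sq, hk.xb, hσ]
    · rw [Perm.mul_apply, Perm.mul_apply, sk, hk.xc, hσ, gp]
    · intro t t1 t2 t3
      rw [Perm.mul_apply, Perm.mul_apply, hk.fix, ← Perm.mul_apply, mul_inv_cancel, Perm.one_apply]
      · rwa [Ne, Perm.inv_eq_iff_eq, hσ, gp]
      · rwa [Ne, Perm.inv_eq_iff_eq, hσ, gq]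
      · rwa [Ne, Perm.inv_eq_iff_eq, hσ]
  -- agreement on everything
  let E : Subgroup (alternatingGroup α) :=
    MonoidHom.eqLocus (MulAut.conjNormal σ : MulAut (alternatingGroup α)).toMonoidHom f.toMonoidHom
  have hE : E = ⊤ := by
    rw [eq_top_iff, ← alternatingGroup.closure_isThreeCycles_eq_top, Subgroup.closure_le]
    intro x hx
    obtain ⟨a', b', c', hx'⟩ := exists_tri (show (x : Perm α).IsThreeCycle from hx)
    have h3 := all_cyc (E.map (alternatingGroup α).subtype) pq (fun k k1 k2 => by
      refine ⟨X ⟨k, k1, k2⟩, hgen _, rfl⟩) a' b' c' hx'.ab hx'.ac hx'.bc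
    obtain ⟨y, hy, hyx⟩ := h3
    have : y = x := Subtype.ext (hyx.trans ((tri_cyc hx'.ab hx'.ac hx'.bc).eq hx'))
    rw [← this]; exact hy
  ext1 x
  have : x ∈ E := by rw [hE]; trivial
  exact this

end
end VQ
namespace VQ
section
open Nat in
theorem ineq_aux (j m : ℕ) (h : ¬ (j = 0 ∧ m = 0)) :
    2 * (3 ^ (j + 2) * (j + 2)! * m !) < 3 * (m + 3 * j + 3)! := by
  have step : ∀ j m : ℕ, 2 * (3 ^ (j + 2) * (j + 2)! * m !) < 3 * (m + 3 * j + 3)! →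
      2 * (3 ^ (j + 2) * (j + 2)! * (m + 1)!) < 3 * (m + 1 + 3 * j + 3)! := by
    intro j m h
    have e1 : (m + 1 + 3 * j + 3)! = (m + 3 * j + 4) * (m + 3 * j + 3)! := by
      rw [show m + 1 + 3 * j + 3 = (m + 3 * j + 3) + 1 by ring, factorial_succ]
    rw [e1, factorial_succ m]
    nlinarith [Nat.factorial_pos (m + 3 * j + 3), Nat.zero_le (3 * j + 3)]
  have base : ∀ j : ℕ, 2 * (3 ^ (j + 1 + 2) * (j + 1 + 2)! * 0 !) < 3 * (0 + 3 * (j + 1) + 3)! := by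
    intro j
    induction j with
    | zero => decide
    | succ j ih =>
      have e1 : (0 + 3 * (j + 1 + 1) + 3)! =
          (3 * j + 9) * (3 * j + 8) * (3 * j + 7) * (0 + 3 * (j + 1) + 3)! := by
        rw [show 0 + 3 * (j + 1 + 1) + 3 = (0 + 3 * (j + 1) + 3) + 1 + 1 + 1 by ring,
          factorial_succ, factorial_succ, factorial_succ]
        ring
      have e2 : 3 ^ (j + 1 + 1 + 2) * (j + 1 + 1 + 2)! * 0 ! =
          (3 * (j + 4)) * (3 ^ (j + 1 + 2) * (j + 1 + 2)! * 0 !) := by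
        rw [show j + 1 + 1 + 2 = (j + 1 + 2) + 1 by ring, factorial_succ, pow_succ]
        ring
      rw [e1, e2]
      have h3 : 3 * (j + 4) ≤ (3 * j + 9) * (3 * j + 8) * (3 * j + 7) := by
        have h4 : 3 * (j + 4) ≤ (3 * j + 9) * (3 * j + 8) := by nlinarith
        exact h4.trans (Nat.le_mul_of_pos_right _ (by omega))
      calc 2 * (3 * (j + 4) * (3 ^ (j + 1 + 2) * (j + 1 + 2)! * 0 !))
          = (3 * (j + 4)) * (2 * (3 ^ (j + 1 + 2) * (j + 1 + 2)! * 0 !)) := by ring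
        _ < (3 * (j + 4)) * (3 * (0 + 3 * (j + 1) + 3)!) :=
            Nat.mul_lt_mul_of_pos_left ih (by positivity)
        _ ≤ ((3 * j + 9) * (3 * j + 8) * (3 * j + 7)) * (3 * (0 + 3 * (j + 1) + 3)!) :=
            Nat.mul_le_mul_right _ h3
        _ = _ := by ring
  rcases j with _ | j
  · rcases m with _ | m
    · simp at h
    · clear h
      induction m with
      | zero => decide
      | succ m ih => exact step _ _ ih
  · clear h
    induction m with
    | zero => exact base j
    | succ m ih => exact step _ _ ih

variable {α : Type*} [Fintype α] [DecidableEq α]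

theorem card_cent_le (x : alternatingGroup α) :
    Nat.card (Subgroup.centralizer {x}) ≤ Nat.card (Subgroup.centralizer {(x : Perm α)}) := by
  refine Nat.card_le_card_of_injective (fun y => ⟨(y.1 : Perm α), ?_⟩) ?_
  · have := y.2
    rw [Subgroup.mem_centralizer_singleton_iff] at this ⊢
    exact congrArg Subtype.val this
  · intro y z h
    have h' : (y.1 : Perm α) = (z.1 : Perm α) := by simpa using h
    exact Subtype.ext (Subtype.ext h')

theorem cent_le (x : alternatingGroup α) :
    Nat.card (Subgroup.centralizer {(x : Perm α)}) ≤ 2 * Nat.card (Subgroup.centralizer {x}) := by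
  set C := Subgroup.centralizer {(x : Perm α)} with hC
  have h1 := Subgroup.card_mul_index ((alternatingGroup α).subgroupOf C)
  have h2 : ((alternatingGroup α).subgroupOf C).index ≤ 2 := by
    have h3 : (alternatingGroup α).relIndex C ∣ (alternatingGroup α).index :=
      Subgroup.relIndex_dvd_index_of_normal _ _
    have h4 : (alternatingGroup α).index ∣ 2 := by
      rcases subsingleton_or_nontrivial α
      · rw [alternatingGroup.index_eq_one]; exact one_dvd 2
      · rw [alternatingGroup.index_eq_two]
    exact Nat.le_of_dvd two_pos (h3.trans h4)
  have h3 : Nat.card ((alternatingGroup α).subgroupOf C) ≤ Nat.card (Subgroup.centralizer {x}) := by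
    refine Nat.card_le_card_of_injective (fun y => ⟨⟨(y.1 : Perm α), y.2⟩, ?_⟩) ?_
    · have := Subgroup.mem_centralizer_singleton_iff.1 y.1.2
      rw [Subgroup.mem_centralizer_singleton_iff]
      exact Subtype.ext this
    · intro y z h
      have h' : (y.1 : Perm α) = (z.1 : Perm α) := 
        congrArg (fun t : ↥(Subgroup.centralizer {x}) => ((t.1 : alternatingGroup α) : Perm α)) h
      exact Subtype.ext (Subtype.ext h')
  rw [← h1, mul_comm]
  exact Nat.mul_le_mul h2 h3

theorem cent_aut (f : MulAut (alternatingGroup α)) (x : alternatingGroup α) :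
    Nat.card (Subgroup.centralizer {x}) ≤ Nat.card (Subgroup.centralizer {f x}) := by
  refine Nat.card_le_card_of_injective (fun y => ⟨f y.1, ?_⟩) ?_
  · have := y.2
    rw [Subgroup.mem_centralizer_singleton_iff] at this ⊢
    rw [← map_mul, this, map_mul]
  · intro y z h
    exact Subtype.ext (f.injective (congrArg Subtype.val h))

open Nat in
theorem card_cent_three (y : Perm α) (k : ℕ) (h : y.cycleType = Multiset.replicate (k + 1) 3) :
    Nat.card (Subgroup.centralizer {y}) =
      (Fintype.card α - 3 * (k + 1))! * 3 ^ (k + 1) * (k + 1)! := by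
  rw [nat_card_centralizer, h]
  simp only [Multiset.sum_replicate, Multiset.prod_replicate, smul_eq_mul,
    Multiset.toFinset_replicate, if_neg (Nat.succ_ne_zero k), Finset.prod_singleton,
    Multiset.count_replicate_self, mul_comm 3]

theorem image_three (f : MulAut (alternatingGroup α)) (x : alternatingGroup α)
    (hx : (x : Perm α).IsThreeCycle) : (f x : Perm α).IsThreeCycle ∨
      (Fintype.card α = 6 ∧ (f x : Perm α).cycleType = {3, 3}) := by
  have ho : orderOf (f x : Perm α) = 3 := by
    rw [Subgroup.orderOf_coe, MulEquiv.orderOf_eq, ← Subgroup.orderOf_coe, hx.orderOf]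
  obtain ⟨k, hk⟩ := cycleType_prime_order (σ := (f x : Perm α)) (by rw [ho]; exact Nat.prime_three)
  rw [ho] at hk
  have hsum := sum_cycleType_le (f x : Perm α)
  rw [hk] at hsum
  simp only [Multiset.sum_replicate, smul_eq_mul] at hsum
  rcases k with _ | j
  · left; rw [IsThreeCycle, hk]; rfl
  right
  by_cases h : j = 0 ∧ Fintype.card α - 3 * (j + 2) = 0
  · obtain ⟨rfl, h⟩ := h
    refine ⟨by omega, ?_⟩
    rw [hk]; rfl
  exfalso
  have h1 := ineq_aux j _ h
  have h2 := card_cent_three _ _ hk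
  have h3 := card_cent_three (x : Perm α) 0 hx
  have h4 := cent_le x
  have h5 := cent_aut f x
  have h6 := card_cent_le (f x)
  rw [h3] at h4
  rw [h2] at h6
  rw [show Fintype.card α - 3 * (j + 2) + 3 * j + 3 = Fintype.card α - 3 * (0 + 1) by omega] at h1
  simp only [zero_add, pow_one, Nat.factorial_one, mul_one] at h4 h1
  have h7 := h4.trans (Nat.mul_le_mul_left 2 (h5.trans h6))
  rw [show j + 1 + 1 = j + 2 from rfl] at h7
  nlinarith

theorem conjNormal_injective (hα : 4 ≤ Fintype.card α) : Function.Injective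
    (MulAut.conjNormal : Perm α →* MulAut (alternatingGroup α)) := by
  rw [injective_iff_map_eq_one]
  intro σ h
  by_contra hσ
  obtain ⟨a, ha⟩ : ∃ a, σ a ≠ a := by
    by_contra! hc
    exact hσ (Equiv.ext hc)
  obtain ⟨c, hc⟩ : ∃ c, c ∉ ({a, σ a} : Finset α) := by
    by_contra! hc
    have := Finset.card_le_card (fun x _ => hc x : Finset.univ ⊆ ({a, σ a} : Finset α))
    have h2 := Finset.card_le_two (a := a) (b := σ a)
    rw [Finset.card_univ] at this
    omega
  obtain ⟨d, hd⟩ : ∃ d, d ∉ ({a, σ a, c} : Finset α) := by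
    by_contra! hc
    have := Finset.card_le_card (fun x _ => hc x : Finset.univ ⊆ ({a, σ a, c} : Finset α))
    have h2 := Finset.card_le_three (a := a) (b := σ a) (c := c)
    rw [Finset.card_univ] at this
    omega
  simp only [Finset.mem_insert, Finset.mem_singleton, not_or] at hc hd
  have ac : a ≠ c := Ne.symm hc.1
  have ad : a ≠ d := Ne.symm hd.1
  have cd : c ≠ d := Ne.symm hd.2.2
  have h1 := congrArg Subtype.val (DFunLike.congr_fun h
    ⟨cyc a c d, (cyc_three ac ad cd).mem_alternatingGroup⟩)
  rw [MulAut.conjNormal_apply] at h1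
  have h2 : σ * cyc a c d = cyc a c d * σ := by
    have h1 : σ * cyc a c d * σ⁻¹ = cyc a c d := h1
    exact mul_inv_eq_iff_eq_mul.1 h1
  have h3 : σ (cyc a c d d) = cyc a c d (σ d) := DFunLike.congr_fun h2 d
  rw [(tri_cyc ac ad cd).xc] at h3
  have h4 : cyc a c d (σ a) = σ a := (tri_cyc ac ad cd).fix _ ha (Ne.symm hc.2) (Ne.symm hd.2.1)
  exact ad.symm (σ.injective ((cyc a c d).injective (h3.symm.trans h4.symm)))

end

theorem card_conj_congr {G H : Type*} [Group G] [Group H] (e : G ≃* H) :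
    Nat.card (ConjClasses G) = Nat.card (ConjClasses H) := by
  refine Nat.card_congr ⟨ConjClasses.map e.toMonoidHom, ConjClasses.map e.symm.toMonoidHom, ?_, ?_⟩
  · rintro ⟨a⟩
    exact congrArg ConjClasses.mk (e.symm_apply_apply a)
  · rintro ⟨a⟩
    exact congrArg ConjClasses.mk (e.apply_symm_apply a)

theorem big_case (n : ℕ) (hn : 4 ≤ n) (h6 : n ≠ 6) :
    Nat.card (VirtualClasses (conjS (alternatingGroup (Fin n)))) =
      Fintype.card (Nat.Partition n) := by
  have e : Perm (Fin n) ≃* MulAut (alternatingGroup (Fin n)) :=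
    MulEquiv.ofBijective MulAut.conjNormal ⟨conjNormal_injective (by simpa using hn), fun f =>
      conj_of_three (by simpa using hn) f (fun x hx => (image_three f x hx).resolve_right
        (fun h => h6 (by simpa using h.1)))⟩
  rw [card_virtual_center _ (alternatingGroup.center_eq_bot (by simpa using hn)),
    ← card_conj_congr e, card_conjClasses_perm, Fintype.card_fin]
end VQ
namespace VQ
section

theorem emb {A : Type} [Group A] [IsSimpleGroup A] (hnc : ∃ a b : A, a * b ≠ b * a)
    (Ω : Type) [MulAction A Ω] [MulAction.IsPretransitive A Ω] (hΩ : Nat.card Ω = 6) :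
    ∃ (e : Ω ≃ Fin 6) (ψ : A →* alternatingGroup (Fin 6)), Function.Injective ψ ∧
      ∀ a w, (ψ a : Perm (Fin 6)) (e w) = e (a • w) := by
  have : Finite Ω := Nat.finite_of_card_ne_zero (by omega)
  let e : Ω ≃ Fin 6 := Finite.equivFinOfCardEq hΩ
  let φ : A →* Perm (Fin 6) := (Equiv.permCongrHom e).toMonoidHom.comp (MulAction.toPermHom A Ω)
  have hφ : ∀ a w, φ a (e w) = e (a • w) := by
    intro a w
    change e (a • e.symm (e w)) = _
    rw [e.symm_apply_apply]
  have hs : ∀ a, Perm.sign (φ a) = 1 := by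
    rcases (Perm.sign.comp φ).normal_ker.eq_bot_or_eq_top with h | h
    · exfalso
      rw [MonoidHom.ker_eq_bot_iff] at h
      obtain ⟨a, b, hab⟩ := hnc
      apply hab
      apply h
      rw [map_mul, map_mul, mul_comm]
    · intro a
      have : a ∈ (Perm.sign.comp φ).ker := by rw [h]; trivial
      exact this
  have hi : Function.Injective φ := by
    rcases φ.normal_ker.eq_bot_or_eq_top with h | h
    · rwa [MonoidHom.ker_eq_bot_iff] at h
    · exfalso
      obtain ⟨a, ha⟩ := MulAction.exists_smul_eq A (e.symm 0) (e.symm 1)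
      have h1 : φ a = 1 := by
        have : a ∈ φ.ker := by rw [h]; trivial
        exact this
      have h2 := hφ a (e.symm 0)
      rw [ha, h1] at h2
      simp at h2
  refine ⟨e, φ.codRestrict (alternatingGroup (Fin 6)) (fun a => mem_alternatingGroup.2 (hs a)),
    ?_, hφ⟩
  intro a b h
  exact hi (congrArg Subtype.val h)

theorem simple_alt (n : ℕ) (hn : 5 ≤ n) : IsSimpleGroup (alternatingGroup (Fin n)) :=
  alternatingGroup.isSimpleGroup (by simpa using hn)

theorem exists_three_cycle (n : ℕ) (hn : 4 ≤ n) : ∃ y : Perm (Fin n), y.IsThreeCycle :=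
  ⟨cyc ⟨0, by omega⟩ ⟨1, by omega⟩ ⟨2, by omega⟩, cyc_three (by simp) (by simp) (by simp)⟩

theorem noncomm_alt (n : ℕ) (hn : 4 ≤ n) : ∃ a b : alternatingGroup (Fin n), a * b ≠ b * a := by
  by_contra! h
  have h1 : Subgroup.center (alternatingGroup (Fin n)) = ⊥ :=
    alternatingGroup.center_eq_bot (by simpa using hn)
  obtain ⟨y, hy⟩ := exists_three_cycle n hn
  have h2 : (⟨y, hy.mem_alternatingGroup⟩ : alternatingGroup (Fin n)) ∈
      Subgroup.center (alternatingGroup (Fin n)) := Subgroup.mem_center_iff.2 (fun g => h _ _)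
  rw [h1, Subgroup.mem_bot] at h2
  have h3 : y = 1 := congrArg Subtype.val h2
  have := hy.orderOf
  rw [h3, orderOf_one] at this
  omega

theorem fix_of_three (y : Perm (Fin 6)) (hy : y.IsThreeCycle) : ∃ i, y i = i := by
  by_contra! h
  have h1 : y.support = Finset.univ := by
    ext i; simp [h i]
  have h2 := hy.card_support
  rw [h1] at h2
  simp at h2

theorem card_alt5 : Nat.card (alternatingGroup (Fin 5)) = 60 := by
  rw [nat_card_alternatingGroup]; simp; decide
theorem card_alt6 : Nat.card (alternatingGroup (Fin 6)) = 360 := by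
  rw [nat_card_alternatingGroup]; simp; decide

theorem card_syl : Nat.card (Sylow 5 (alternatingGroup (Fin 5))) = 6 := by
  have : Fact (Nat.Prime 5) := ⟨by norm_num⟩
  have := simple_alt 5 le_rfl
  have h1 := card_sylow_modEq_one 5 (alternatingGroup (Fin 5))
  obtain ⟨P⟩ : Nonempty (Sylow 5 (alternatingGroup (Fin 5))) := inferInstance
  have h2 := P.card_dvd_index
  have h3 := P.card_eq_multiplicity
  rw [card_alt5] at h3
  have h4 : Nat.factorization 60 5 = 1 := by
    rw [Nat.factorization_def _ (by norm_num)]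
    rw [show 60 = 5 * 12 by rfl, padicValNat.mul (by norm_num) (by norm_num), padicValNat_self,
      padicValNat.eq_zero_of_not_dvd (by norm_num)]
  rw [h4, pow_one] at h3
  have h5 := P.1.card_mul_index
  rw [card_alt5] at h5
  have h6 : P.1.index = 12 := by
    have h3 : Nat.card P.1 = 5 := h3
    rw [h3] at h5; omega
  rw [show (P : Subgroup (alternatingGroup (Fin 5))).index = 12 from h6] at h2
  have h7 : Nat.card (Sylow 5 (alternatingGroup (Fin 5))) ≠ 1 := by
    intro h
    have : Subsingleton (Sylow 5 (alternatingGroup (Fin 5))) := (Nat.card_eq_one_iff_unique.1 h).1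
    have hP := P.normal_of_subsingleton
    have h3 : Nat.card P.1 = 5 := h3
    rcases hP.eq_bot_or_eq_top with h | h
    · have h : P.1 = ⊥ := h
      rw [h] at h3
      simp at h3
    · have h : P.1 = ⊤ := h
      rw [h, Subgroup.index_top] at h6
      omega
  generalize Nat.card (Sylow 5 (alternatingGroup (Fin 5))) = m at *
  have : m ≤ 12 := Nat.le_of_dvd (by norm_num) h2
  unfold Nat.ModEq at h1
  interval_cases m <;> omega

theorem exists_H : ∃ H : Subgroup (alternatingGroup (Fin 6)), H.index = 6 ∧
    ∀ x ∈ H, ¬ (x : Perm (Fin 6)).IsThreeCycle := by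
  have : Fact (Nat.Prime 5) := ⟨by norm_num⟩
  have := simple_alt 5 le_rfl
  obtain ⟨e, ψ, hi, hψ⟩ := emb (noncomm_alt 5 (by norm_num))
    (Sylow 5 (alternatingGroup (Fin 5))) card_syl
  refine ⟨ψ.range, ?_, ?_⟩
  · have h1 := ψ.range.card_mul_index
    rw [← Nat.card_congr (MonoidHom.ofInjective hi).toEquiv, card_alt5, card_alt6] at h1
    omega
  · rintro _ ⟨a, rfl⟩ h
    obtain ⟨i, hfix⟩ := fix_of_three _ h
    have h1 := hψ a (e.symm i)
    rw [e.apply_symm_apply, hfix] at h1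
    have h2 : a ∈ MulAction.stabilizer (alternatingGroup (Fin 5)) (e.symm i) := by
      rw [MulAction.mem_stabilizer_iff, e.eq_symm_apply, ← h1]
    have h3 : orderOf a = 3 := by
      rw [← orderOf_injective ψ hi, ← Subgroup.orderOf_coe, h.orderOf]
    have h4 := MulAction.index_stabilizer_of_transitive (alternatingGroup (Fin 5)) (e.symm i)
    have h5 := (MulAction.stabilizer (alternatingGroup (Fin 5)) (e.symm i)).card_mul_index
    rw [h4, card_syl, card_alt5] at h5
    have h6 : Nat.card (MulAction.stabilizer (alternatingGroup (Fin 5)) (e.symm i)) = 10 := by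
      omega
    have h7 := Subgroup.orderOf_dvd_natCard _ h2
    rw [h6, h3] at h7
    omega

theorem exists_outer : ∃ τ : MulAut (alternatingGroup (Fin 6)),
    ∀ x : alternatingGroup (Fin 6), (x : Perm (Fin 6)).IsThreeCycle →
      ¬ (τ x : Perm (Fin 6)).IsThreeCycle := by
  have := simple_alt 6 (by norm_num)
  obtain ⟨H, hH, hH3⟩ := exists_H
  obtain ⟨e, ψ, hi, hψ⟩ := emb (noncomm_alt 6 (by norm_num)) (alternatingGroup (Fin 6) ⧸ H) hH
  refine ⟨MulEquiv.ofBijective ψ (Finite.injective_iff_bijective.1 hi), ?_⟩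
  intro x hx h
  have h : (ψ x : Perm (Fin 6)).IsThreeCycle := h
  obtain ⟨i, hfix⟩ := fix_of_three _ h
  have h1 := hψ x (e.symm i)
  rw [e.apply_symm_apply, hfix, ← e.symm_apply_eq] at h1
  obtain ⟨g, hg⟩ := QuotientGroup.mk_surjective (e.symm i)
  rw [← hg] at h1
  have h1 : (g : alternatingGroup (Fin 6) ⧸ H) = ((x * g : alternatingGroup (Fin 6)) : _ ⧸ H) := h1
  have h2 := QuotientGroup.eq.1 h1
  refine hH3 _ h2 ?_
  rw [IsThreeCycle]
  rw [IsThreeCycle] at hx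
  rw [← hx, ← cycleType_conj (τ := ((g : Perm (Fin 6)))⁻¹) (σ := (x : Perm (Fin 6)))]
  congr 1
end
end VQ
namespace VQ
section

/-- The possible cycle types of permutations of six letters. -/
def types6 : Finset (Multiset ℕ) :=
  {0, {2}, {2, 2}, {2, 2, 2}, {3}, {3, 2}, {3, 3}, {4}, {4, 2}, {5}, {6}}

/-- The cycle types preserved by outer automorphisms. -/
def fixed6 : Finset (Multiset ℕ) := {0, {2, 2}, {4}, {4, 2}, {5}}


theorem part_types (t : Multiset ℕ) (ht : t.sum ≤ 6 ∧ ∀ a ∈ t, 2 ≤ a) : t ∈ types6 := by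
  obtain ⟨l, rfl⟩ := Quot.exists_rep t
  change (l : Multiset ℕ).sum ≤ 6 ∧ ∀ a ∈ (l : Multiset ℕ), 2 ≤ a at ht
  change (l : Multiset ℕ) ∈ types6
  rcases l with _ | ⟨a, _ | ⟨b, _ | ⟨c, _ | ⟨d, l⟩⟩⟩⟩
  · decide
  · simp at ht
    obtain ⟨h1, h2⟩ := ht
    interval_cases a <;> decide
  · simp at ht
    obtain ⟨h1, h2, h3⟩ := ht
    have h4 : a ≤ 4 := by omega
    have h5 : b ≤ 4 := by omega
    interval_cases a <;> interval_cases b <;> first | omega | decide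
  · simp at ht
    obtain ⟨h1, h2, h3, h4⟩ := ht
    obtain rfl : a = 2 := by omega
    obtain rfl : b = 2 := by omega
    obtain rfl : c = 2 := by omega
    decide
  · simp at ht
    omega

theorem mem_types (σ : Perm (Fin 6)) : σ.cycleType ∈ types6 := by
  have := sum_cycleType_le σ
  rw [Fintype.card_fin] at this
  exact part_types _ ⟨this, fun a ha => two_le_of_mem_cycleType ha⟩

theorem dec_fixed : ∀ t ∈ fixed6, ∀ u ∈ types6, t.lcm = u.lcm →
    (-1 : ℤˣ) ^ (t.sum + t.card) = (-1) ^ (u.sum + u.card) → u = t := by decide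
theorem dec_222 : ∀ t ∈ types6, t.lcm = 2 → t.sum = 6 → t = {2, 2, 2} := by decide
theorem dec_33 : ∀ t ∈ types6, t.lcm = 3 → t.sum = 6 → t = {3, 3} := by decide
theorem dec_3 : ∀ t ∈ types6, t.lcm = 3 → t.sum ≤ 5 → t = {3} := by decide
theorem dec_2 : ∀ t ∈ types6, t.lcm = 2 → t.sum ≤ 5 → (-1 : ℤˣ) ^ (t.sum + t.card) = -1 →
    t = {2} := by decide
theorem dec_6 : ∀ t ∈ types6, t.lcm = 6 → t = {6} ∨ t = {3, 2} := by decide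
theorem dec_rest : ∀ t ∈ types6, t ∈ fixed6 ∨ t = {2} ∨ t = {2, 2, 2} ∨ t = {3} ∨ t = {3, 2} ∨
    t = {3, 3} ∨ t = {6} := by decide

theorem pow_six {w : Perm (Fin 6)} (h : w.cycleType = {6}) :
    (w ^ 3).cycleType = {2, 2, 2} ∧ (w ^ 4).cycleType = {3, 3} := by
  have ho : orderOf w = 6 := by rw [← lcm_cycleType, h]; rfl
  have hc : w.IsCycle := by rw [← card_cycleType_eq_one, h]; rfl
  have hs : ∀ n, ¬ 6 ∣ n → (w ^ n).cycleType.sum = 6 := by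
    intro n hn
    rw [sum_cycleType, hc.support_pow_eq_iff.2 (by rwa [ho]), ← sum_cycleType, h]; rfl
  constructor
  · refine dec_222 _ (mem_types _) ?_ (hs _ (by norm_num))
    rw [lcm_cycleType, orderOf_pow, ho]; rfl
  · refine dec_33 _ (mem_types _) ?_ (hs _ (by norm_num))
    rw [lcm_cycleType, orderOf_pow, ho]; rfl

theorem pow_three_two {w : Perm (Fin 6)} (h : w.cycleType = {3, 2}) :
    (w ^ 3).cycleType = {2} ∧ (w ^ 4).cycleType = {3} := by
  have ho : orderOf w = 6 := by rw [← lcm_cycleType, h]; rfl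
  have hs : ∀ n, (w ^ n).cycleType.sum ≤ 5 := by
    intro n
    rw [sum_cycleType]
    refine (Finset.card_le_card (support_pow_le w n)).trans ?_
    rw [← sum_cycleType, h]; decide
  constructor
  · refine dec_2 _ (mem_types _) ?_ (hs _) ?_
    · rw [lcm_cycleType, orderOf_pow, ho]; rfl
    · rw [← sign_of_cycleType, map_pow, sign_of_cycleType, h]; decide
  · refine dec_3 _ (mem_types _) ?_ (hs _)
    rw [lcm_cycleType, orderOf_pow, ho]; rfl

theorem exists_root {m : Multiset ℕ} (hm : m.sum ≤ 6 ∧ ∀ a ∈ m, 2 ≤ a) {k : ℕ} {t : Multiset ℕ}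
    (hk : ∀ w : Perm (Fin 6), w.cycleType = m → (w ^ k).cycleType = t) (σ : Perm (Fin 6))
    (hσ : σ.cycleType = t) : ∃ w : Perm (Fin 6), w.cycleType = m ∧ w ^ k = σ := by
  obtain ⟨w, hw⟩ := (exists_with_cycleType_iff (Fin 6)).2 (by simpa using hm)
  have h1 : IsConj (w ^ k) σ := isConj_iff_cycleType_eq.2 ((hk w hw).trans hσ.symm)
  obtain ⟨c, hc⟩ := isConj_iff.1 h1
  exact ⟨c * w * c⁻¹, by rw [cycleType_conj, hw], by rw [conj_pow, hc]⟩

theorem class_iff (θ : MulAut (Perm (Fin 6))) (hs : ∀ σ, sign (θ σ) = sign σ)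
    (h3 : ∀ σ, σ.cycleType = {3} → (θ σ).cycleType = {3, 3})
    (h33 : ∀ σ, σ.cycleType = {3, 3} → (θ σ).cycleType = {3}) (σ : Perm (Fin 6)) :
    (θ σ).cycleType = σ.cycleType ↔ σ.cycleType ∈ fixed6 := by
  have hne : ({3, 3} : Multiset ℕ) ≠ {3} := by decide
  have h6 : ∀ w : Perm (Fin 6), w.cycleType = {6} → (θ w).cycleType = {3, 2} := by
    intro w hw
    have ho : (θ w).cycleType.lcm = 6 := by
      rw [lcm_cycleType, MulEquiv.orderOf_eq, ← lcm_cycleType, hw]; rfl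
    refine (dec_6 _ (mem_types _) ho).resolve_left (fun h => ?_)
    have h1 := (pow_six h).2
    rw [← map_pow, h33 _ (pow_six hw).2] at h1
    exact hne h1.symm
  have h32 : ∀ w : Perm (Fin 6), w.cycleType = {3, 2} → (θ w).cycleType = {6} := by
    intro w hw
    have ho : (θ w).cycleType.lcm = 6 := by
      rw [lcm_cycleType, MulEquiv.orderOf_eq, ← lcm_cycleType, hw]; rfl
    refine (dec_6 _ (mem_types _) ho).resolve_right (fun h => ?_)
    have h1 := (pow_three_two h).2
    rw [← map_pow, h3 _ (pow_three_two hw).2] at h1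
    exact hne h1
  constructor
  · intro h
    rcases dec_rest _ (mem_types σ) with h' | h' | h' | h' | h' | h' | h'
    · exact h'
    · exfalso
      obtain ⟨w, hw, rfl⟩ := exists_root (m := {3, 2}) (by decide)
        (fun w hw => (pow_three_two hw).1) σ h'
      rw [h', map_pow, (pow_six (h32 w hw)).1] at h
      exact absurd h (by decide)
    · exfalso
      obtain ⟨w, hw, rfl⟩ := exists_root (m := {6}) (by decide)
        (fun w hw => (pow_six hw).1) σ h'
      rw [h', map_pow, (pow_three_two (h6 w hw)).1] at h
      exact absurd h (by decide)
    · rw [h3 _ h', h'] at h; exact absurd h (by decide)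
    · rw [h32 _ h', h'] at h; exact absurd h (by decide)
    · rw [h33 _ h', h'] at h; exact absurd h (by decide)
    · rw [h6 _ h', h'] at h; exact absurd h (by decide)
  · intro h
    refine dec_fixed _ h _ (mem_types _) ?_ ?_
    · rw [lcm_cycleType, lcm_cycleType, MulEquiv.orderOf_eq]
    · rw [← sign_of_cycleType, ← sign_of_cycleType, hs]

theorem class_sum (t : Multiset ℕ) (ht : t.sum ≤ 6 ∧ ∀ a ∈ t, 2 ≤ a) :
    ∑ k : Perm (Fin 6), (if k.cycleType = t then Nat.card (Subgroup.centralizer {k}) else 0) =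
      720 := by
  have h1 := card_of_cycleType_mul_eq (Fin 6) t
  rw [if_pos (by simpa using ht)] at h1
  rw [← Finset.sum_filter]
  rw [Finset.sum_congr rfl (g := fun _ => (Fintype.card (Fin 6) - t.sum).factorial * t.prod *
    ∏ n ∈ t.toFinset, (t.count n).factorial), Finset.sum_const, smul_eq_mul, h1]
  · decide
  · intro k hk
    rw [nat_card_centralizer, (Finset.mem_filter.1 hk).2]

theorem types_sum (F : Finset (Multiset ℕ)) (hF : ∀ t ∈ F, t.sum ≤ 6 ∧ ∀ a ∈ t, 2 ≤ a) :
    ∑ k : Perm (Fin 6), (if k.cycleType ∈ F then Nat.card (Subgroup.centralizer {k}) else 0) =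
      F.card * 720 := by
  have h1 : ∀ k : Perm (Fin 6),
      (if k.cycleType ∈ F then Nat.card (Subgroup.centralizer {k}) else 0) =
      ∑ t ∈ F, if k.cycleType = t then Nat.card (Subgroup.centralizer {k}) else 0 := by
    intro k
    rw [Finset.sum_ite_eq]
  rw [Finset.sum_congr rfl (fun k _ => h1 k), Finset.sum_comm, Finset.sum_congr rfl
    (fun t ht => class_sum t (hF t ht)), Finset.sum_const, smul_eq_mul]

theorem fixed_sum :
    ∑ k : Perm (Fin 6), (if k.cycleType ∈ fixed6 then Nat.card (Subgroup.centralizer {k}) else 0) =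
      5 * 720 :=
  types_sum fixed6 (by decide)

theorem all_sum :
    ∑ k : Perm (Fin 6), (if k.cycleType ∈ types6 then Nat.card (Subgroup.centralizer {k}) else 0) =
      11 * 720 :=
  types_sum types6 (by decide)

end
end VQ
namespace VQ
section

/-- Conjugation by permutations as automorphisms of the alternating group. -/
abbrev kap : Perm (Fin 6) →* MulAut (alternatingGroup (Fin 6)) := MulAut.conjNormal

theorem kap_inj : Function.Injective kap := conjNormal_injective (by simp)

theorem kap_type (σ : Perm (Fin 6)) (x : alternatingGroup (Fin 6)) :
    (kap σ x : Perm (Fin 6)).cycleType = (x : Perm (Fin 6)).cycleType := by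
  rw [MulAut.conjNormal_apply, cycleType_conj]

theorem mem_K (f : MulAut (alternatingGroup (Fin 6))) (x : alternatingGroup (Fin 6))
    (hx : (x : Perm (Fin 6)).cycleType = {3}) :
    f ∈ kap.range ↔ (f x : Perm (Fin 6)).cycleType = {3} := by
  constructor
  · rintro ⟨σ, rfl⟩
    rw [kap_type, hx]
  · intro h
    refine conj_of_three (by simp) f (fun y hy => ?_)
    obtain ⟨c, hc⟩ := isConj_iff.1 (alternatingGroup.isThreeCycle_isConj (by simp) hx hy)
    rw [← hc]
    simp only [map_mul, map_inv, Subgroup.coe_mul, Subgroup.coe_inv]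
    rw [IsThreeCycle, cycleType_conj, h]

theorem exists_T3 : ∃ x : alternatingGroup (Fin 6), (x : Perm (Fin 6)).cycleType = {3} := by
  obtain ⟨y, hy⟩ := exists_three_cycle 6 (by norm_num)
  exact ⟨⟨y, hy.mem_alternatingGroup⟩, hy⟩

theorem out_three {f : MulAut (alternatingGroup (Fin 6))} (hf : f ∉ kap.range)
    (x : alternatingGroup (Fin 6)) (hx : (x : Perm (Fin 6)).cycleType = {3}) :
    (f x : Perm (Fin 6)).cycleType = {3, 3} := by
  rw [mem_K f x hx] at hf
  exact ((image_three f x hx).resolve_left hf).2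

theorem conj_33 (x y : alternatingGroup (Fin 6)) (hx : (x : Perm (Fin 6)).cycleType = {3, 3})
    (hy : (y : Perm (Fin 6)).cycleType = {3, 3}) : ∃ c : alternatingGroup (Fin 6),
      c * x * c⁻¹ = y := by
  obtain ⟨σ, hσ⟩ := isConj_iff.1 (isConj_iff_cycleType_eq.2 (hx.trans hy.symm))
  by_cases hs : σ ∈ alternatingGroup (Fin 6)
  · exact ⟨⟨σ, hs⟩, Subtype.ext hσ⟩
  · have h1 : ¬ (Subgroup.centralizer {(x : Perm (Fin 6))} ≤ alternatingGroup (Fin 6)) := by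
      rw [centralizer_le_alternating_iff, hx]
      rintro ⟨-, -, h⟩
      exact absurd (h 3) (by decide)
    obtain ⟨c, hc, hc'⟩ := SetLike.not_le_iff_exists.1 h1
    rw [Subgroup.mem_centralizer_singleton_iff] at hc
    have hm : σ * c ∈ alternatingGroup (Fin 6) := by
      rw [mem_alternatingGroup] at hs hc' ⊢
      rw [map_mul, (Int.units_eq_one_or _).resolve_left hs,
        (Int.units_eq_one_or _).resolve_left hc']
      rfl
    refine ⟨⟨σ * c, hm⟩, Subtype.ext ?_⟩
    change σ * c * (x : Perm (Fin 6)) * (σ * c)⁻¹ = y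
    rw [← hσ, mul_assoc σ, hc]
    group

theorem out_33 {f : MulAut (alternatingGroup (Fin 6))} (hf : f ∉ kap.range)
    (y : alternatingGroup (Fin 6)) (hy : (y : Perm (Fin 6)).cycleType = {3, 3}) :
    (f y : Perm (Fin 6)).cycleType = {3} := by
  obtain ⟨x, hx⟩ := exists_T3
  have h1 : f⁻¹ ∉ kap.range := fun h => hf (inv_inv f ▸ kap.range.inv_mem h)
  obtain ⟨c, hc⟩ := conj_33 _ _ (out_three h1 x hx) hy
  rw [← hc]
  simp only [map_mul, map_inv, Subgroup.coe_mul, Subgroup.coe_inv]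
  rw [cycleType_conj, MulAut.apply_inv_self, hx]

theorem out_mul {f g : MulAut (alternatingGroup (Fin 6))} (hf : f ∉ kap.range)
    (hg : g ∉ kap.range) : f * g ∈ kap.range := by
  obtain ⟨x, hx⟩ := exists_T3
  rw [mem_K _ x hx]
  exact out_33 hf _ (out_three hg x hx)

theorem range_normal : kap.range.Normal := by
  refine ⟨fun k hk g => ?_⟩
  by_cases hg : g ∈ kap.range
  · exact kap.range.mul_mem (kap.range.mul_mem hg hk) (kap.range.inv_mem hg)
  · refine out_mul (fun h => hg ?_) (fun h => hg ?_)
    · have := kap.range.mul_mem h (kap.range.inv_mem hk)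
      rwa [mul_inv_cancel_right] at this
    · exact inv_inv g ▸ kap.range.inv_mem h

theorem kap_coe (g : MulAut (alternatingGroup (Fin 6))) (a : alternatingGroup (Fin 6)) :
    kap (g a : Perm (Fin 6)) = g * kap (a : Perm (Fin 6)) * g⁻¹ := by
  ext1 x
  apply Subtype.ext
  obtain ⟨y, rfl⟩ := g.surjective x
  simp only [MulAut.mul_apply, MulAut.inv_apply_self]
  rw [MulAut.conjNormal_apply]
  have : kap (a : Perm (Fin 6)) y = a * y * a⁻¹ := Subtype.ext (by
    rw [MulAut.conjNormal_apply]; rfl)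
  rw [this, map_mul, map_mul, map_inv]
  rfl

theorem exists_theta (g : MulAut (alternatingGroup (Fin 6))) (hg : g ∉ kap.range) :
    ∃ θ : MulAut (Perm (Fin 6)), (∀ σ, kap (θ σ) = g * kap σ * g⁻¹) ∧
      ∀ σ, (θ σ).cycleType = σ.cycleType ↔ σ.cycleType ∈ fixed6 := by
  have := range_normal
  let e : Perm (Fin 6) ≃* kap.range := MonoidHom.ofInjective kap_inj
  let θ : MulAut (Perm (Fin 6)) :=
    (e.trans (MulAut.conjNormal g : MulAut kap.range)).trans e.symm
  have h1 : ∀ σ, kap (θ σ) = g * kap σ * g⁻¹ := by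
    intro σ
    have h2 : e (θ σ) = (MulAut.conjNormal g : MulAut kap.range) (e σ) := e.apply_symm_apply _
    have h3 := congrArg Subtype.val h2
    rw [MulAut.conjNormal_apply] at h3
    exact h3
  have h2 : ∀ a : alternatingGroup (Fin 6), θ (a : Perm (Fin 6)) = (g a : Perm (Fin 6)) := by
    intro a
    apply kap_inj
    rw [h1, kap_coe]
  refine ⟨θ, h1, class_iff θ ?_ ?_ ?_⟩
  · have h3 : ∀ σ, sign (θ σ) = 1 ↔ sign σ = 1 := by
      intro σ
      constructor
      · intro h
        obtain ⟨a, ha⟩ := g.surjective ⟨θ σ, mem_alternatingGroup.2 h⟩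
        have h4 : θ (a : Perm (Fin 6)) = θ σ := by rw [h2, ha]
        rw [← θ.injective h4]
        exact mem_alternatingGroup.1 a.2
      · intro h
        have := h2 ⟨σ, mem_alternatingGroup.2 h⟩
        rw [show θ σ = _ from this]
        exact mem_alternatingGroup.1 (g _).2
    intro σ
    rcases Int.units_eq_one_or (sign σ) with h | h
    · rw [h, (h3 σ).2 h]
    · rw [h]
      refine (Int.units_eq_one_or _).resolve_left (fun h4 => ?_)
      rw [(h3 σ).1 h4] at h
      exact absurd h (by decide)
  · intro σ h
    rw [show θ σ = _ from h2 ⟨σ, IsThreeCycle.mem_alternatingGroup h⟩]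
    exact out_three hg _ h
  · intro σ h
    have hm : σ ∈ alternatingGroup (Fin 6) := by
      rw [mem_alternatingGroup, sign_of_cycleType, h]; decide
    rw [show θ σ = _ from h2 ⟨σ, hm⟩]
    exact out_33 hg ⟨σ, hm⟩ h

open Classical in
theorem inner_sum (k k' : Perm (Fin 6)) :
    (∑ s : Perm (Fin 6), if s * k * s⁻¹ = k' then 1 else 0) =
      if k'.cycleType = k.cycleType then Nat.card (Subgroup.centralizer {k}) else 0 := by
  split_ifs with h
  · obtain ⟨c, hc⟩ := isConj_iff.1 (isConj_iff_cycleType_eq.2 h.symm)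
    rw [← Equiv.sum_comp (Equiv.mulLeft c), ← Finset.card_filter, Nat.card_eq_fintype_card,
      Fintype.card_subtype]
    congr 1
    ext s
    simp only [Finset.mem_filter, Finset.mem_univ, true_and, Equiv.coe_mulLeft]
    rw [Subgroup.mem_centralizer_singleton_iff, ← hc]
    constructor
    · intro h
      have h : c * s * k * (c * s)⁻¹ = c * k * c⁻¹ := (Finset.mem_filter.1 h).2
      have h1 : c * (s * k * s⁻¹) * c⁻¹ = c * k * c⁻¹ := by rw [← h]; group
      have h2 := mul_left_cancel (mul_right_cancel h1)
      exact mul_inv_eq_iff_eq_mul.1 h2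
    · intro h
      have h2 : s * k * s⁻¹ = k := mul_inv_eq_iff_eq_mul.2 h
      refine Finset.mem_filter.2 ⟨Finset.mem_univ _, ?_⟩
      calc c * s * k * (c * s)⁻¹ = c * (s * k * s⁻¹) * c⁻¹ := by group
        _ = _ := by rw [h2]
  · apply Finset.sum_eq_zero
    intro s _
    rw [if_neg]
    rintro rfl
    exact h cycleType_conj

open Classical in
theorem sum_KK : (∑ k : Perm (Fin 6), ∑ s : Perm (Fin 6),
    if Commute (kap k) (kap s) then 1 else 0) = 11 * 720 := by
  rw [← all_sum]
  refine Finset.sum_congr rfl (fun k _ => ?_)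
  rw [if_pos (mem_types k)]
  have h := inner_sum k k
  rw [if_pos rfl] at h
  rw [← h]
  refine Finset.sum_congr rfl (fun s _ => if_congr ?_ rfl rfl)
  rw [mul_inv_eq_iff_eq_mul, commute_iff_eq, ← map_mul, ← map_mul, kap_inj.eq_iff, eq_comm]

open Classical in
theorem sum_KO (g : MulAut (alternatingGroup (Fin 6))) (hg : g ∉ kap.range) :
    (∑ k : Perm (Fin 6), ∑ s : Perm (Fin 6),
      if Commute (kap k) (g * kap s) then 1 else 0) = 5 * 720 := by
  obtain ⟨θ, h1, h2⟩ := exists_theta g⁻¹ (fun h => hg (inv_inv g ▸ kap.range.inv_mem h))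
  rw [← fixed_sum]
  refine Finset.sum_congr rfl (fun k _ => ?_)
  rw [← if_congr (h2 k) rfl rfl, ← inner_sum]
  refine Finset.sum_congr rfl (fun s _ => if_congr ?_ rfl rfl)
  rw [← kap_inj.eq_iff, h1, map_mul, map_mul, map_inv, inv_inv, mul_inv_eq_iff_eq_mul,
    commute_iff_eq]
  constructor
  · intro h
    rw [mul_assoc (g⁻¹ * kap k), mul_assoc g⁻¹, h]; group
  · intro h
    rw [mul_assoc, h]; group

theorem card_conj_six : Nat.card (ConjClasses (MulAut (alternatingGroup (Fin 6)))) = 13 := by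
  classical
  obtain ⟨g, hg3⟩ := exists_outer
  have hg : g ∉ kap.range := by
    obtain ⟨x, hx⟩ := exists_T3
    rw [mem_K g x hx]
    exact hg3 x hx
  let F : Perm (Fin 6) ⊕ Perm (Fin 6) → MulAut (alternatingGroup (Fin 6)) :=
    Sum.elim kap (fun s => g * kap s)
  have hF : Function.Bijective F := by
    constructor
    · rintro (a | a) (b | b) h
      · exact congrArg Sum.inl (kap_inj h)
      · have h : kap a = g * kap b := h
        refine absurd ⟨a * b⁻¹, ?_⟩ hg
        rw [map_mul, map_inv, h, mul_inv_cancel_right]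
      · have h : g * kap a = kap b := h
        refine absurd ⟨b * a⁻¹, ?_⟩ hg
        rw [map_mul, map_inv, ← h, mul_inv_cancel_right]
      · exact congrArg Sum.inr (kap_inj (mul_left_cancel h))
    · intro f
      by_cases hf : f ∈ kap.range
      · obtain ⟨a, rfl⟩ := hf
        exact ⟨Sum.inl a, rfl⟩
      · obtain ⟨a, ha⟩ := out_mul (f := g⁻¹)
          (fun h => hg (inv_inv g ▸ kap.range.inv_mem h)) hf
        refine ⟨Sum.inr a, ?_⟩
        change g * kap a = f
        rw [ha, mul_inv_cancel_left]
  let E := Equiv.ofBijective F hF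
  have hcard : Nat.card (MulAut (alternatingGroup (Fin 6))) = 1440 := by
    rw [← Nat.card_congr E, Nat.card_sum, Nat.card_perm, Nat.card_fin]; rfl
  have h := card_comm_eq_card_conjClasses_mul_card (MulAut (alternatingGroup (Fin 6)))
  rw [hcard, ← Nat.card_congr (Equiv.subtypeEquiv (p := fun p => Commute (F p.1) (F p.2))
    (Equiv.prodCongr E E) (fun p => Iff.rfl)), Nat.card_eq_fintype_card, Fintype.card_subtype,
    Finset.card_filter, Fintype.sum_prod_type, Fintype.sum_sum_type] at h
  simp only [Fintype.sum_sum_type, Finset.sum_add_distrib] at h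
  have h1 : (∑ k : Perm (Fin 6), ∑ s : Perm (Fin 6),
    if Commute (F (Sum.inl k)) (F (Sum.inl s)) then 1 else 0) = 11 * 720 := sum_KK
  have h2 : (∑ k : Perm (Fin 6), ∑ s : Perm (Fin 6),
    if Commute (F (Sum.inl k)) (F (Sum.inr s)) then 1 else 0) = 5 * 720 := sum_KO g hg
  have h3 : (∑ k : Perm (Fin 6), ∑ s : Perm (Fin 6),
      if Commute (F (Sum.inr k)) (F (Sum.inl s)) then 1 else 0) = 5 * 720 := by
    rw [Finset.sum_comm, ← h2]
    exact Finset.sum_congr rfl (fun _ _ => Finset.sum_congr rfl (fun _ _ =>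
      if_congr ⟨Commute.symm, Commute.symm⟩ rfl rfl))
  have h4 : (∑ k : Perm (Fin 6), ∑ s : Perm (Fin 6),
      if Commute (F (Sum.inr k)) (F (Sum.inr s)) then 1 else 0) = 5 * 720 := by
    rw [← h3]
    refine Finset.sum_congr rfl (fun k _ => ?_)
    rw [← Equiv.sum_comp (Equiv.mulLeft k)]
    refine Finset.sum_congr rfl (fun s _ => if_congr ?_ rfl rfl)
    change Commute (g * kap k) (g * kap (k * s)) ↔ Commute (g * kap k) (kap s)
    rw [map_mul, ← mul_assoc]
    constructor
    · intro h
      have := (Commute.refl (g * kap k)).inv_right.mul_right h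
      rwa [inv_mul_cancel_left] at this
    · intro h
      exact (Commute.refl (g * kap k)).mul_right h
  rw [h1, h2, h3, h4] at h
  omega

theorem six_case : Nat.card (VirtualClasses (conjS (alternatingGroup (Fin 6)))) = 13 := by
  rw [card_virtual_center _ (alternatingGroup.center_eq_bot (by simp)), card_conj_six]
end
end VQ
/-- The number of isomorphism classes of virtual quandles whose underlying quandle is the
conjugation quandle of the alternating group `A_n` equals `p(n)` if `n ∉ {2, 6}`, equals
`1` if `n = 2`, and equals `13` if `n = 6`. -/
theorem stmt_12 (n : ℕ) (hn : 0 < n) :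
    (n ≠ 2 → n ≠ 6 → Nat.card (VirtualClasses (conjS (alternatingGroup (Fin n)))) =
      Fintype.card (Nat.Partition n)) ∧
    (n = 2 → Nat.card (VirtualClasses (conjS (alternatingGroup (Fin n)))) = 1) ∧
    (n = 6 → Nat.card (VirtualClasses (conjS (alternatingGroup (Fin n)))) = 13) := by
  refine ⟨fun h2 h6 => ?_, ?_, ?_⟩
  · by_cases h4 : 4 ≤ n
    · exact VQ.big_case n h4 h6
    · have h3 : n = 1 ∨ n = 3 := by omega
      rcases h3 with rfl | rfl
      · rw [VQ.small_case 1 (by norm_num), show Fintype.card (alternatingGroup (Fin 1)) = 1 by decide]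
      · rw [VQ.small_case 3 (by norm_num), show Fintype.card (alternatingGroup (Fin 3)) = 3 by decide]
  · rintro rfl
    rw [VQ.small_case 2 (by norm_num), show Fintype.card (alternatingGroup (Fin 2)) = 1 by decide]
    exact VQ.part_one
  · rintro rfl
    exact VQ.six_case
end
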